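/- arXiv:1010.5192 — 2 statements merged into one kernel-verified Lean document; each statement's English description precedes it below -/
import Mathlib

section
/- Let G be a regular multigraph of order 2n with multiplicity at most r, where n^{5/6} > 3r. Suppose the vertex set of G can be partitioned into two parts A and B with |A| = |B| = n such that every vertex v satisfies d_A(v) > rn/2 + 14·r·n^{5/6} and d_B(v) > rn/2 + 14·r·n^{5/6}, and such that max{Δ(G_A), Δ(G_B)} − min{δ(G_A), δ(G_B)} < n^{2/3}, where G_A and G_B denote the subgraphs of G induced by A and B respectively, and Δ and δ denote maximum and minimum degree. Then G is 1-factorizable. -/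
/-- The degree of a vertex in a multigraph `m : V → V → ℕ`. -/
def mDeg {V : Type*} [Fintype V] (m : V → V → ℕ) (v : V) : ℕ :=
  ∑ w, m v w

/-- A 1-factor (perfect matching) of the multigraph `m`: a sub-multigraph in which
every vertex has degree exactly one. -/
def IsOneFactor {V : Type*} [Fintype V] (m f : V → V → ℕ) : Prop :=
  (∀ u v, f u v = f v u) ∧ (∀ u v, f u v ≤ m u v) ∧ ∀ v, ∑ w, f v w = 1

/-- A multigraph is 1-factorizable if its edge set (with parallel edges counted
with multiplicity) can be partitioned into 1-factors. -/
def OneFactorizable {V : Type*} [Fintype V] (m : V → V → ℕ) : Prop :=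
  ∃ (k : ℕ) (F : Fin k → V → V → ℕ),
    (∀ i, IsOneFactor m (F i)) ∧ ∀ u v, ∑ i, F i u v = m u v

namespace OneFactorization

open Finset

lemma exists_closed_card_fixed_le_two {V : Type*} [Fintype V] [DecidableEq V]
    {α β : V → V} (hα : Function.Involutive α) (hβ : Function.Involutive β) {y : V}
    (hy : β y = y) :
    ∃ P : Finset V, y ∈ P ∧ (∀ v ∈ P, α v ∈ P) ∧ (∀ v ∈ P, β v ∈ P) ∧
      #{v ∈ P | α v = v} + #{v ∈ P | β v = v} ≤ 2 := by
  classical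
  set ρ : V → V := fun v => α (β v) with hρ
  have hinj : Function.Injective ρ := hα.injective.comp hβ.injective
  have hper : y ∈ Function.periodicPts ρ := hinj.mem_periodicPts y
  set o := Function.minimalPeriod ρ y with ho
  have ho0 : 0 < o := Function.minimalPeriod_pos_of_mem_periodicPts hper
  have hoy : ρ^[o] y = y := Function.iterate_minimalPeriod
  have hconj : ∀ j, ρ^[j] (β (ρ^[j] y)) = y := by
    intro j
    induction j with
    | zero => simpa using hy
    | succ j ih =>
      rw [Function.iterate_succ_apply ρ j (β _), Function.iterate_succ_apply' ρ j y]
      have : ρ (β (ρ (ρ^[j] y))) = β (ρ^[j] y) := by simp [hρ, hβ _, hα _]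
      rw [this, ih]
  have hα' : ∀ j, α (ρ^[j+1] y) = β (ρ^[j] y) := by
    intro j
    rw [Function.iterate_succ_apply']
    simp [hρ, hα _]
  have hβmem : ∀ j, j ≤ o → β (ρ^[j] y) = ρ^[o - j] y := by
    intro j hj
    apply hinj.iterate j
    rw [hconj, ← Function.iterate_add_apply, Nat.add_sub_cancel' hj, hoy]
  have key : ∀ j, ∃ j' < o, ρ^[j'] y = ρ^[j] y := fun j =>
    ⟨j % o, Nat.mod_lt _ ho0, by rw [ho, Function.iterate_mod_minimalPeriod_eq]⟩
  set P : Finset V := (range o).image (fun j => ρ^[j] y) with hP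
  have hmem : ∀ j, ρ^[j] y ∈ P := by
    intro j
    obtain ⟨j', h, h'⟩ := key j
    exact mem_image.2 ⟨j', mem_range.2 h, h'⟩
  have hcl : ∀ v ∈ P, β v ∈ P := by
    intro v hv
    obtain ⟨j, hj, rfl⟩ := mem_image.1 hv
    rw [hβmem j (mem_range.1 hj).le]
    exact hmem _
  refine ⟨P, hmem 0, ?_, hcl, ?_⟩
  · intro v hv
    obtain ⟨j, hj, rfl⟩ := mem_image.1 hv
    cases j with
    | zero =>
      have : α y = ρ^[1] y := by simp [hρ, hy]
      simpa [this] using hmem 1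
    | succ j => rw [hα']; exact hcl _ (hmem _)
  · have hb : ∀ v ∈ P, β v = v → v = y ∨ (o % 2 = 0 ∧ v = ρ^[o / 2] y) := by
      intro v hv h
      obtain ⟨j, hj, rfl⟩ := mem_image.1 hv
      have h1 := hconj j
      rw [h, ← Function.iterate_add_apply] at h1
      have h2 : o ∣ j + j := Function.IsPeriodicPt.minimalPeriod_dvd h1
      have hj := mem_range.1 hj
      obtain ⟨c, hc⟩ := h2
      have : c < 2 := by nlinarith
      interval_cases c
      · left; have : j = 0 := by omega
        simp [this]
      · right
        refine ⟨by omega, ?_⟩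
        have : j = o / 2 := by omega
        simp [← this]
    have ha : ∀ v ∈ P, α v = v → o % 2 = 1 ∧ v = ρ^[(o + 1) / 2] y := by
      intro v hv h
      obtain ⟨j, hj, rfl⟩ := mem_image.1 hv
      have hj := mem_range.1 hj
      cases j with
      | zero =>
        simp only [Function.iterate_zero, id] at h
        have h1 : ρ^[1] y = y := by simp [hρ, hy, h]
        have h2 : o ∣ 1 := Function.IsPeriodicPt.minimalPeriod_dvd h1
        have h3 : o = 1 := Nat.dvd_one.1 h2
        simp only [h3]
        simp [hρ, hy, h]
      | succ j =>
        have h1 := hconj j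
        rw [← hα', h, ← Function.iterate_add_apply] at h1
        have h2 : o ∣ j + (j + 1) := Function.IsPeriodicPt.minimalPeriod_dvd h1
        obtain ⟨c, hc⟩ := h2
        have : c < 2 := by nlinarith
        interval_cases c
        · omega
        · refine ⟨by omega, ?_⟩
          have : j + 1 = (o + 1) / 2 := by omega
          simp only [this]
    rcases Nat.mod_two_eq_zero_or_one o with h | h
    · have h1 : #{v ∈ P | α v = v} = 0 := by
        rw [card_eq_zero, filter_eq_empty_iff]
        intro v hv hh
        have := (ha v hv hh).1
        omega
      have h2 : ({v ∈ P | β v = v} : Finset V) ⊆ {y, ρ^[o / 2] y} := by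
        intro v hv
        rw [mem_filter] at hv
        rcases hb v hv.1 hv.2 with h | h <;> simp [h]
      have := (card_le_card h2).trans card_le_two
      omega
    · have h1 : ({v ∈ P | α v = v} : Finset V) ⊆ {ρ^[(o + 1) / 2] y} := by
        intro v hv
        rw [mem_filter] at hv
        simp [(ha v hv.1 hv.2).2]
      have h2 : ({v ∈ P | β v = v} : Finset V) ⊆ {y} := by
        intro v hv
        rw [mem_filter] at hv
        rcases hb v hv.1 hv.2 with h | h
        · simp [h]
        · omega
      have := card_le_card h1
      have := card_le_card h2
      simp only [card_singleton] at *
      omega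

lemma exists_closed_card_inter_lt {V : Type*} [Fintype V] [DecidableEq V]
    {α β : V → V} (hα : Function.Involutive α) (hβ : Function.Involutive β) {X Y : Finset V}
    (hY : ∀ v ∈ Y, β v = v) (hXY : #X < #Y) :
    ∃ C : Finset V, (∀ v ∈ C, α v ∈ C) ∧ (∀ v ∈ C, β v ∈ C) ∧
      #(X ∩ C) < #(Y ∩ C) ∧ #(Y ∩ C) ≤ #(X ∩ C) + 2 := by
  classical
  let S : Finset (Finset V) := {C | (∀ v ∈ C, α v ∈ C) ∧ (∀ v ∈ C, β v ∈ C) ∧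
      #(X ∩ C) < #(Y ∩ C)}
  have hS : S.Nonempty := ⟨univ, by simpa [S] using hXY⟩
  obtain ⟨C, hC, hmin⟩ := exists_min_image S card hS
  obtain ⟨hCα, hCβ, hlt⟩ := (mem_filter.1 hC).2
  refine ⟨C, hCα, hCβ, hlt, ?_⟩
  obtain ⟨y, hy⟩ : (Y ∩ C).Nonempty := card_pos.1 (by omega)
  rw [mem_inter] at hy
  obtain ⟨P, hyP, hPα, hPβ, hcard⟩ := exists_closed_card_fixed_le_two hα hβ (hY y hy.1)
  have hlt' : ¬ #(X ∩ (C \ P)) < #(Y ∩ (C \ P)) := by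
    intro h
    have hm : C \ P ∈ S := by
      refine mem_filter.2 ⟨mem_univ _, ?_, ?_, h⟩
      · intro v hv
        rw [mem_sdiff] at hv ⊢
        exact ⟨hCα v hv.1, fun h => hv.2 (by simpa [hα v] using hPα _ h)⟩
      · intro v hv
        rw [mem_sdiff] at hv ⊢
        exact ⟨hCβ v hv.1, fun h => hv.2 (by simpa [hβ v] using hPβ _ h)⟩
    have h1 := hmin _ hm
    have h2 : #(C \ P) < #C := card_lt_card
      ⟨sdiff_subset, fun h => (mem_sdiff.1 (h hy.2)).2 hyP⟩
    omega
  have hsplit : ∀ Z : Finset V, #(Z ∩ C) = #(Z ∩ (C \ P)) + #((Z ∩ C) ∩ P) := by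
    intro Z
    rw [← card_sdiff_add_card_inter (Z ∩ C) P, inter_sdiff_assoc]
  have h1 : #((Y ∩ C) ∩ P) ≤ #{v ∈ P | β v = v} := by
    apply card_le_card
    intro v hv
    simp only [mem_inter] at hv
    exact mem_filter.2 ⟨hv.2, hY v hv.1.1⟩
  have := hsplit X
  have := hsplit Y
  omega

/-- One coloured family arises from another by permuting, at every vertex separately, the colours
in `I`. -/
def LocalPerm {ι V : Type*} (I : Finset ι) (σ : ι → V → V) (X : ι → Finset V)
    (σ' : ι → V → V) (X' : ι → Finset V) : Prop :=
  ∀ u, ∃ π : Equiv.Perm ι, (∀ i ∉ I, π i = i) ∧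
    ∀ i, σ' i u = σ (π i) u ∧ (u ∈ X' i ↔ u ∈ X (π i))

section

variable {ι V : Type*} {I : Finset ι} {σ σ' : ι → V → V} {X X' : ι → Finset V}

lemma LocalPerm.refl (I : Finset ι) (σ : ι → V → V) (X : ι → Finset V) : LocalPerm I σ X σ X :=
  fun _ => ⟨1, by simp, by simp⟩

lemma LocalPerm.trans {σ'' : ι → V → V} {X'' : ι → Finset V} (h : LocalPerm I σ X σ' X')
    (h' : LocalPerm I σ' X' σ'' X'') : LocalPerm I σ X σ'' X'' := by
  intro u
  obtain ⟨π, h1, h2⟩ := h u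
  obtain ⟨π', h1', h2'⟩ := h' u
  refine ⟨π'.trans π, fun i hi => by simp [h1' i hi, h1 i hi], fun i => ?_⟩
  simp [h2', h2]

lemma LocalPerm.card_filter_eq [Fintype ι] [DecidableEq V] (h : LocalPerm I σ X σ' X') (u w : V) :
    #{i | σ' i u = w} = #{i | σ i u = w} := by
  obtain ⟨π, -, h2⟩ := h u
  exact card_equiv π (by simp [h2])

lemma LocalPerm.card_filter_mem [Fintype ι] [DecidableEq V] (h : LocalPerm I σ X σ' X') (u : V) :
    #{i | u ∈ X' i} = #{i | u ∈ X i} := by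
  obtain ⟨π, -, h2⟩ := h u
  exact card_equiv π (by simp [h2])

lemma LocalPerm.apply_eq (h : LocalPerm I σ X σ' X') {i : ι} (hi : i ∉ I) (u : V) :
    σ' i u = σ i u := by
  obtain ⟨π, h1, h2⟩ := h u
  rw [(h2 i).1, h1 i hi]

lemma LocalPerm.mem_iff (h : LocalPerm I σ X σ' X') {i : ι} (hi : i ∉ I) (u : V) :
    u ∈ X' i ↔ u ∈ X i := by
  obtain ⟨π, h1, h2⟩ := h u
  rw [(h2 i).2, h1 i hi]

/-- By Kempe changes the sets `X i` can be made to have almost equal sizes. -/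
lemma exists_localPerm_balanced [Fintype ι] [DecidableEq ι] [Fintype V] [DecidableEq V]
    (I : Finset ι) : ∀ (N : ℕ) (σ : ι → V → V) (X : ι → Finset V),
    (∀ i, Function.Involutive (σ i)) → (∀ i, ∀ v ∈ X i, σ i v = v) → ∑ i, #(X i) ^ 2 ≤ N →
    ∃ σ' X', (∀ i, Function.Involutive (σ' i)) ∧ (∀ i, ∀ v ∈ X' i, σ' i v = v) ∧
      LocalPerm I σ X σ' X' ∧ ∀ i ∈ I, ∀ j ∈ I, #(X' i) ≤ #(X' j) + 2 := by
  intro N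
  induction N using Nat.strong_induction_on with
  | _ N ih =>
    intro σ X hσ hX hN
    by_cases hbal : ∀ i ∈ I, ∀ j ∈ I, #(X i) ≤ #(X j) + 2
    · exact ⟨σ, X, hσ, hX, LocalPerm.refl _ _ _, hbal⟩
    push Not at hbal
    obtain ⟨i, hi, j, hj, hij⟩ := hbal
    have hne : i ≠ j := by rintro rfl; omega
    obtain ⟨C, hCj, hCi, hlt, hle⟩ :=
      exists_closed_card_inter_lt (hσ j) (hσ i) (hX i) (show #(X j) < #(X i) by omega)
    let π : V → Equiv.Perm ι := fun v => if v ∈ C then Equiv.swap i j else 1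
    let τ : ι → V → V := fun l v => σ (π v l) v
    let Y : ι → Finset V := fun l => {v | v ∈ X (π v l)}
    have hπC : ∀ v ∈ C, π v = Equiv.swap i j := fun v hv => by simp [π, hv]
    have hπC' : ∀ v ∉ C, π v = 1 := fun v hv => by simp [π, hv]
    have hoff : ∀ l, l ≠ i → l ≠ j → ∀ v, π v l = l := by
      intro l h1 h2 v
      by_cases hv : v ∈ C
      · simp [hπC v hv, Equiv.swap_apply_of_ne_of_ne h1 h2]
      · simp [hπC' v hv]
    have hCmem : ∀ l, l = i ∨ l = j → ∀ v, σ l v ∈ C ↔ v ∈ C := by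
      rintro l (rfl | rfl) v
      · exact ⟨fun h => by simpa [hσ _ v] using hCi _ h, hCi v⟩
      · exact ⟨fun h => by simpa [hσ _ v] using hCj _ h, hCj v⟩
    have hτ : ∀ l, Function.Involutive (τ l) := by
      intro l v
      by_cases hl : l = i ∨ l = j
      · have hl' : ∀ v, π v l = i ∨ π v l = j := by
          intro v
          by_cases hv : v ∈ C
          · rw [hπC v hv]; rcases hl with rfl | rfl <;> simp
          · rw [hπC' v hv]; simpa using hl
        have h1 := hCmem _ (hl' v) v
        have h2 : π (σ (π v l) v) = π v := by simp only [π, h1]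
        simp only [τ, h2, hσ _ v]
      · push Not at hl
        simp [τ, hoff l hl.1 hl.2, hσ l v]
    have hY : ∀ l, ∀ v ∈ Y l, τ l v = v := by
      intro l v hv
      exact hX _ _ (mem_filter.1 hv).2
    have hlp : LocalPerm I σ X τ Y := by
      intro u
      refine ⟨π u, fun l hl => hoff l (by rintro rfl; exact hl hi) (by rintro rfl; exact hl hj) u,
        fun l => ⟨rfl, by simp [Y]⟩⟩
    have hYi : #(Y i) + #(X i ∩ C) = #(X i) + #(X j ∩ C) := by
      have : Y i = (X i \ C) ∪ (X j ∩ C) := by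
        ext v
        by_cases hv : v ∈ C <;> simp [Y, π, hv]
      rw [this, card_union_of_disjoint]
      · have := card_sdiff_add_card_inter (X i) C
        omega
      · exact disjoint_left.2 fun v h h' => (mem_sdiff.1 h).2 (mem_inter.1 h').2
    have hYj : #(Y j) + #(X j ∩ C) = #(X j) + #(X i ∩ C) := by
      have : Y j = (X j \ C) ∪ (X i ∩ C) := by
        ext v
        by_cases hv : v ∈ C <;> simp [Y, π, hv]
      rw [this, card_union_of_disjoint]
      · have := card_sdiff_add_card_inter (X j) C
        omega
      · exact disjoint_left.2 fun v h h' => (mem_sdiff.1 h).2 (mem_inter.1 h').2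
    have hYl : ∀ l, l ≠ i → l ≠ j → Y l = X l := by
      intro l h1 h2
      ext v
      simp [Y, hoff l h1 h2]
    have hsum : ∑ l, #(Y l) ^ 2 < ∑ l, #(X l) ^ 2 := by
      have hd : ∀ f : ι → ℕ, ∑ l, f l = f i + (f j + ∑ l ∈ (univ.erase i).erase j, f l) := by
        intro f
        rw [add_sum_erase _ f (by simp [hne.symm]), add_sum_erase _ f (mem_univ i)]
      rw [hd, hd (fun l => #(X l) ^ 2)]
      have hr : ∑ l ∈ (univ.erase i).erase j, #(Y l) ^ 2 =
          ∑ l ∈ (univ.erase i).erase j, #(X l) ^ 2 := by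
        refine sum_congr rfl fun l hl => ?_
        simp only [mem_erase] at hl
        rw [hYl l hl.2.1 hl.1]
      rw [hr]
      obtain ⟨δ, hδ⟩ := Nat.exists_eq_add_of_lt hlt
      have h1 : #(Y i) + (δ + 1) = #(X i) := by omega
      have h2 : #(Y j) = #(X j) + (δ + 1) := by omega
      have h3 : #(X j) < #(Y i) := by omega
      rw [← h1, h2]
      nlinarith
    obtain ⟨σ', X', h1, h2, h3, h4⟩ := ih _ (lt_of_lt_of_le hsum hN) τ Y hτ hY le_rfl
    exact ⟨σ', X', h1, h2, hlp.trans h3, h4⟩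

end

/-- If every vertex `u` is missed by (almost) `2 * w u` colours, then after Kempe changes
one can reserve `w u` missing colours at each vertex `u`, with all reserved colours distinct. -/
lemma exists_localPerm_assignment {ι V : Type*} [Fintype ι] [DecidableEq ι] [Fintype V]
    [DecidableEq V] : ∀ (D : ℕ) (w : V → ℕ) (I : Finset ι) (σ : ι → V → V) (X : ι → Finset V),
    ∑ u, w u = D → D ≤ #I → (∀ i, Function.Involutive (σ i)) → (∀ i, ∀ v ∈ X i, σ i v = v) →
    (∀ i ∉ I, X i = ∅) → (∃ u₀, ∀ u, 2 * w u ≤ #{i | u ∈ X i} + if u = u₀ then 1 else 0) →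
    ∃ σ', (∀ i, Function.Involutive (σ' i)) ∧ LocalPerm I σ (fun _ => ∅) σ' (fun _ => ∅) ∧
      ∃ c : ι → Option V, (∀ i u, c i = some u → i ∈ I ∧ σ' i u = u) ∧
        ∀ u, #{i | c i = some u} = w u := by
  intro D
  induction D with
  | zero =>
    intro w I σ X hw _ hσ _ _ _
    refine ⟨σ, hσ, LocalPerm.refl _ _ _, fun _ => none, by simp, ?_⟩
    intro u
    have := (sum_eq_zero_iff.1 hw) u (mem_univ _)
    simp [this]
  | succ D ih =>
    intro w I σ X hw hI hσ hX hXI ⟨u₀, hu₀⟩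
    obtain ⟨u₁, hu₁, hu₁'⟩ : ∃ u₁, 0 < w u₁ ∧
        ∀ u, 2 * w u ≤ #{i | u ∈ X i} + if u = u₁ then 1 else 0 := by
      by_cases h : 0 < w u₀
      · exact ⟨u₀, h, hu₀⟩
      · obtain ⟨u₁, -, hu₁⟩ : ∃ u ∈ univ, 0 < w u := by
          by_contra! hcon
          have : ∑ u, w u ≤ 0 := by
            simpa using sum_le_sum hcon
          omega
        refine ⟨u₁, hu₁, fun u => ?_⟩
        have := hu₀ u
        split_ifs at this with h1
        · subst h1; omega
        · omega
    have hS : ∀ u, ∃ S : Finset ι, S ⊆ ({i | u ∈ X i} : Finset ι) ∧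
        #S = 2 * w u - if u = u₁ then 1 else 0 := by
      intro u
      apply exists_subset_card_eq
      have := hu₁' u
      omega
    choose S hSX hScard using hS
    let X₁ : ι → Finset V := fun i => {u | i ∈ S u}
    have hX₁ : ∀ i, ∀ v ∈ X₁ i, v ∈ X i := by
      intro i v hv
      exact (mem_filter.1 (hSX v (mem_filter.1 hv).2)).2
    have hX₁card : ∀ u, #{i | u ∈ X₁ i} = #(S u) := by
      intro u
      congr 1
      ext i
      simp [X₁]
    obtain ⟨σ₂, X₂, hσ₂, hX₂, hlp, hbal⟩ := exists_localPerm_balanced I _ σ X₁ hσ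
      (fun i v hv => hX i v (hX₁ i v hv)) le_rfl
    have hX₂I : ∀ i ∉ I, X₂ i = ∅ := by
      intro i hi
      ext v
      rw [hlp.mem_iff hi]
      simp only [notMem_empty, iff_false]
      intro h
      have := hX₁ i v h
      simp [hXI i hi] at this
    have hX₂card : ∀ u, #{i | u ∈ X₂ i} = 2 * w u - if u = u₁ then 1 else 0 := by
      intro u
      rw [hlp.card_filter_mem, hX₁card, hScard]
    have htot : ∑ i ∈ I, #(X₂ i) + 1 = 2 * (D + 1) := by
      have h1 : ∑ i ∈ I, #(X₂ i) = ∑ i, #(X₂ i) :=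
        sum_subset (subset_univ _) fun i _ hi => by simp [hX₂I i hi]
      have h2 : ∑ i, #(X₂ i) = ∑ u, #{i | u ∈ X₂ i} := by
        have := sum_card_bipartiteAbove_eq_sum_card_bipartiteBelow
          (s := (univ : Finset ι)) (t := (univ : Finset V)) (fun i u => u ∈ X₂ i)
        simpa [bipartiteAbove, bipartiteBelow] using this
      have h3 : ∑ u, (#{i | u ∈ X₂ i} + if u = u₁ then 1 else 0) = ∑ u, 2 * w u := by
        refine sum_congr rfl fun u _ => ?_
        rw [hX₂card]
        split_ifs with h
        · subst h; omega
        · omega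
      rw [sum_add_distrib, ← mul_sum, hw] at h3
      simp at h3
      omega
    obtain ⟨i, hi, hi1⟩ : ∃ i ∈ I, #(X₂ i) = 1 := by
      by_contra! hcon
      obtain ⟨i, hi, hlt⟩ : ∃ i ∈ I, #(X₂ i) < 2 := by
        by_contra! h
        have := sum_le_sum h
        simp at this
        omega
      have h0 : #(X₂ i) = 0 := by have := hcon i hi; omega
      have h2 : ∀ j ∈ I, 2 ∣ #(X₂ j) := by
        intro j hj
        have h3 := hbal j hj i hi
        have h4 := hcon j hj
        omega
      have := dvd_sum h2
      omega
    obtain ⟨u, hu⟩ := card_eq_one.1 hi1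
    let X₃ : ι → Finset V := fun l => if l = i then ∅ else X₂ l
    have hX₃card : ∀ z, #{l | z ∈ X₃ l} + (if z = u then 1 else 0) = #{l | z ∈ X₂ l} := by
      intro z
      by_cases hz : z = u
      · subst hz
        have h1 : ({l | z ∈ X₃ l} : Finset ι) = ({l | z ∈ X₂ l} : Finset ι).erase i := by
          ext l
          by_cases hl : l = i <;> simp [X₃, hl]
        have hmem : i ∈ ({l | z ∈ X₂ l} : Finset ι) := by simp [hu]
        rw [h1, if_pos rfl, card_erase_add_one hmem]
      · rw [if_neg hz, add_zero]
        congr 1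
        ext l
        by_cases hl : l = i
        · subst hl; simp [X₃, hu, hz]
        · simp [X₃, hl]
    have hwu : 0 < w u := by
      have h1 := hX₃card u
      have h2 := hX₂card u
      simp only [if_true] at h1
      omega
    have hupd : ∀ z, (if z = u then w u - 1 else w z) + (if z = u then 1 else 0) = w z := by
      intro z
      split_ifs with h
      · subst h; omega
      · rfl
    obtain ⟨σ', hσ', hlp', c, hc, hcard⟩ := ih (fun z => if z = u then w u - 1 else w z)
      (I.erase i) σ₂ X₃ (by
        have h1 : ∑ z, ((if z = u then w u - 1 else w z) + (if z = u then 1 else 0)) = ∑ z, w z :=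
          sum_congr rfl fun z _ => hupd z
        rw [sum_add_distrib] at h1
        simp only [sum_ite_eq', mem_univ, if_true] at h1
        omega) (by rw [card_erase_of_mem hi]; omega) hσ₂ (by
        intro l v hv
        by_cases hl : l = i
        · simp [X₃, hl] at hv
        · exact hX₂ l v (by simpa [X₃, hl] using hv)) (by
        intro l hl
        by_cases hl' : l = i
        · simp [X₃, hl']
        · simp only [X₃, hl', if_false]
          exact hX₂I l fun h => hl (mem_erase.2 ⟨hl', h⟩)) ⟨u₁, by
        intro z
        have h1 := hX₃card z
        have h2 := hX₂card z
        have h3 := hupd z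
        by_cases hz : z = u
        · subst hz; simp only [if_true] at h1 h3 ⊢; omega
        · simp only [hz, if_false] at h1 h3 ⊢
          split_ifs at h2 ⊢ <;> omega⟩
    have hunit : ∀ z, σ' i z = σ₂ i z := fun z => hlp'.apply_eq (by simp) z
    have hci : c i = none := by
      by_contra hne
      obtain ⟨z, hz⟩ := Option.ne_none_iff_exists'.1 hne
      simpa using (hc i z hz).1
    refine ⟨σ', hσ', ?_, fun l => if l = i then some u else c l, ?_, ?_⟩
    · intro z
      obtain ⟨π, hπ, hπ'⟩ := hlp z
      obtain ⟨π', hπ1, hπ1'⟩ := hlp' z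
      refine ⟨π'.trans π, fun l hl => ?_, fun l => ⟨?_, by simp⟩⟩
      · simp [hπ1 l (fun h => hl (mem_of_mem_erase h)), hπ l hl]
      · simp [hπ1', hπ']
    · intro l z hz
      by_cases hl : l = i
      · subst hl
        simp only [if_true, Option.some.injEq] at hz
        subst hz
        refine ⟨hi, ?_⟩
        rw [hunit]
        exact hX₂ l u (by simp [hu])
      · simp only [hl, if_false] at hz
        exact ⟨mem_of_mem_erase (hc l z hz).1, (hc l z hz).2⟩
    · intro z
      have h1 := hcard z
      have h3 := hupd z
      by_cases hz : z = u
      · subst hz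
        have h4 : ({l | (if l = i then some z else c l) = some z} : Finset ι) =
            insert i ({l | c l = some z} : Finset ι) := by
          ext l
          by_cases hl : l = i <;> simp [hl]
        rw [h4, card_insert_of_notMem (by simp [hci]), h1]
        simpa using h3
      · simp only [hz, if_false, add_zero] at h1 h3
        rw [← h1]
        congr 1
        ext l
        by_cases hl : l = i
        · subst hl; simp [hci, Ne.symm hz]
        · simp [hl]

/-- Match the two points `x` and `y`. -/
def join {V : Type*} [DecidableEq V] (σ : V → V) (x y : V) : V → V :=
  fun v => if v = x then y else if v = y then x else σ v

section

variable {V : Type*} [DecidableEq V] {σ : V → V} {x y : V}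

lemma join_involutive (hσ : Function.Involutive σ) (hx : σ x = x) (hy : σ y = y) :
    Function.Involutive (join σ x y) := by
  intro v
  have h1 : σ v = x → v = x := fun h => by rw [← hσ v, h, hx]
  have h2 : σ v = y → v = y := fun h => by rw [← hσ v, h, hy]
  have := hσ v
  simp only [join]
  grind

lemma join_of_ne {v : V} (h1 : v ≠ x) (h2 : v ≠ y) : join σ x y v = σ v := by simp [join, h1, h2]

lemma join_eq_iff (hx : σ x = x) (hy : σ y = y) {u w : V} (huw : u ≠ w) :
    join σ x y u = w ↔ σ u = w ∨ (u = x ∧ w = y) ∨ (u = y ∧ w = x) := by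
  simp only [join]
  grind

end

/-- **Vizing's theorem** for multigraphs, with colour classes given as involutions. -/
theorem exists_edgeColoring {V : Type*} [Fintype V] [DecidableEq V] {m : V → V → ℕ}
    (hsym : ∀ u v, m u v = m v u) {r Δ : ℕ} (hmult : ∀ u v, m u v ≤ r)
    (hΔ : ∀ u, ∑ w, m u w ≤ Δ) :
    ∃ σ : Fin (Δ + r) → V → V, (∀ i, Function.Involutive (σ i)) ∧
      ∀ u w, u ≠ w → #{i | σ i u = w} = m u w := by
  suffices h : ∀ S : Finset V, ∃ σ : Fin (Δ + r) → V → V, (∀ i, Function.Involutive (σ i)) ∧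
      ∀ u w, u ≠ w → #{i | σ i u = w} = if u ∈ S ∧ w ∈ S then m u w else 0 by
    simpa using h univ
  intro S
  induction S using Finset.induction_on with
  | empty =>
    refine ⟨fun _ => id, fun _ _ => rfl, ?_⟩
    intro u w huw
    simp [huw]
  | insert v S hv ih =>
    obtain ⟨σ, hσ, hcnt⟩ := ih
    have hfixv : ∀ i, σ i v = v := by
      intro i
      by_contra hne
      have := hcnt v (σ i v) (Ne.symm hne)
      rw [if_neg (by tauto), card_eq_zero, filter_eq_empty_iff] at this
      exact this (mem_univ i) rfl
    have hfree : ∀ u ∈ S, #{i | σ i u = u} + ∑ w ∈ S.erase u, m u w = Δ + r := by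
      intro u hu
      have h1 : #(univ : Finset (Fin (Δ + r))) = ∑ w, #{i | σ i u = w} :=
        card_eq_sum_card_fiberwise (by simp)
      rw [card_univ, Fintype.card_fin, ← add_sum_erase _ _ (mem_univ u)] at h1
      refine Eq.trans ?_ h1.symm
      congr 1
      symm
      rw [← sum_subset (erase_subset_erase u (subset_univ S))]
      · refine sum_congr rfl fun w hw => ?_
        rw [mem_erase] at hw
        rw [hcnt u w hw.1.symm, if_pos ⟨hu, hw.2⟩]
      · intro w hw hw'
        simp only [mem_erase, mem_univ, and_true] at hw hw'
        rw [hcnt u w hw.symm, if_neg (by tauto)]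
    obtain ⟨σ', hσ', hlp, c, hc, hccard⟩ := exists_localPerm_assignment _
      (fun u => if u ∈ S then m u v else 0) univ σ
      (fun i => {u | σ i u = u ∧ u ≠ v}) rfl (by
        rw [card_univ, Fintype.card_fin]
        calc _ ≤ ∑ u, m v u := sum_le_sum fun u _ => by
              split_ifs
              · rw [hsym]
              · exact Nat.zero_le _
          _ ≤ Δ + r := (hΔ v).trans (Nat.le_add_right _ _)) hσ (by simp +contextual) (by simp)
      ⟨v, by
        intro u
        by_cases hu : u ∈ S
        · have huv : u ≠ v := by rintro rfl; exact hv hu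
          simp only [hu, if_true, mem_filter, mem_univ, true_and, huv, ne_eq, not_false_eq_true,
            and_true, if_false, add_zero]
          have h1 := hfree u hu
          have h2 : m u v + ∑ w ∈ S.erase u, m u w ≤ Δ := by
            refine le_trans ?_ (hΔ u)
            rw [← sum_insert (f := fun w => m u w) (by simp [hv])]
            exact sum_le_univ_sum_of_nonneg (fun _ => Nat.zero_le _)
          have := hmult u v
          omega
        · simp [hu]⟩
    have hcnt' : ∀ u w, u ≠ w → #{i | σ' i u = w} = if u ∈ S ∧ w ∈ S then m u w else 0 := by
      intro u w huw
      rw [hlp.card_filter_eq, hcnt u w huw]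
    have hfixv' : ∀ i, σ' i v = v := by
      intro i
      have h1 := hlp.card_filter_eq v v
      have h2 : #{i | σ i v = v} = #(univ : Finset (Fin (Δ + r))) := by simp [hfixv]
      rw [h2] at h1
      have h3 := eq_of_subset_of_card_le (filter_subset _ _) h1.ge
      have h4 : i ∈ ({i | σ' i v = v} : Finset (Fin (Δ + r))) := by rw [h3]; exact mem_univ i
      exact (mem_filter.1 h4).2
    let τ : Fin (Δ + r) → V → V := fun i => (c i).elim (σ' i) (fun u => join (σ' i) u v)
    have hτn : ∀ i, c i = none → τ i = σ' i := fun i h => by simp [τ, h]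
    have hτs : ∀ i u, c i = some u → τ i = join (σ' i) u v := fun i u h => by simp [τ, h]
    have key : ∀ i u w, u ≠ w → (τ i u = w ↔ σ' i u = w ∨ (w = v ∧ c i = some u) ∨
        (u = v ∧ c i = some w)) := by
      intro i u w huw
      rcases h : c i with _ | z
      · simp [hτn i h]
      · rw [hτs i z h, join_eq_iff (hc i z h).2 (hfixv' i) huw]
        simp only [Option.some.injEq]
        grind
    refine ⟨τ, ?_, ?_⟩
    · intro i
      rcases h : c i with _ | z
      · rw [hτn i h]; exact hσ' i
      · rw [hτs i z h]; exact join_involutive (hσ' i) (hc i z h).2 (hfixv' i)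
    · intro u w huw
      simp only [key _ u w huw]
      by_cases huv : u = v
      · subst huv
        have h1 : ({i | σ' i u = w ∨ (w = u ∧ c i = some u) ∨ (u = u ∧ c i = some w)} :
            Finset (Fin (Δ + r))) = ({i | c i = some w} : Finset _) := by
          ext i
          simp [hfixv', huw, huw.symm]
        rw [h1, hccard]
        simp [huw.symm, hsym]
      · by_cases hwv : w = v
        · subst hwv
          have h1 : ({i | σ' i u = w ∨ (w = w ∧ c i = some u) ∨ (u = w ∧ c i = some w)} :
              Finset (Fin (Δ + r))) = ({i | c i = some u} : Finset _) := by
            ext i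
            have : σ' i u ≠ w := by
              intro h
              apply huw
              rw [← hσ' i u, h, hfixv']
            simp [this, huw]
          rw [h1, hccard]
          simp [huw]
        · simp only [huv, hwv, false_and, or_false, mem_insert, false_or]
          exact hcnt' u w huw

/-- Colour classes of an edge colouring can be made almost equally large. -/
theorem exists_balanced_edgeColoring {V : Type*} [Fintype V] [DecidableEq V] {m : V → V → ℕ}
    (hsym : ∀ u v, m u v = m v u) {r Δ : ℕ} (hmult : ∀ u v, m u v ≤ r)
    (hΔ : ∀ u, ∑ w, m u w ≤ Δ) :
    ∃ σ : Fin (Δ + r) → V → V, (∀ i, Function.Involutive (σ i)) ∧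
      (∀ u w, u ≠ w → #{i | σ i u = w} = m u w) ∧
      ∀ i j, #{v | σ i v = v} ≤ #{v | σ j v = v} + 2 := by
  obtain ⟨σ, hσ, hcnt⟩ := exists_edgeColoring hsym hmult hΔ
  obtain ⟨σ', X', hσ', hX', hlp, hbal⟩ := exists_localPerm_balanced univ _ σ
    (fun i => {v | σ i v = v}) hσ (by simp) le_rfl
  have hXeq : ∀ i, X' i = ({v | σ' i v = v} : Finset V) := by
    intro i
    ext v
    obtain ⟨π, -, h⟩ := hlp v
    rw [(h i).2]
    simp [(h i).1]
  refine ⟨σ', hσ', fun u w huw => by rw [hlp.card_filter_eq, hcnt u w huw], fun i j => ?_⟩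
  rw [← hXeq, ← hXeq]
  exact hbal i (mem_univ _) j (mem_univ _)

/-- Remove the pair containing `z` from the matching `σ`. -/
def cut {V : Type*} [DecidableEq V] (σ : V → V) (z : V) : V → V :=
  fun v => if v = z ∨ v = σ z then v else σ v

lemma cut_involutive {V : Type*} [DecidableEq V] {σ : V → V} (hσ : Function.Involutive σ) (z : V) :
    Function.Involutive (cut σ z) := by
  intro v
  have h1 := hσ v
  have h2 := hσ z
  simp only [cut]
  grind

lemma even_card_fixed {V : Type*} [Fintype V] [DecidableEq V] {σ : V → V}
    (hσ : Function.Involutive σ) (hV : Even (Fintype.card V)) : Even #{v | σ v = v} := by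
  have : Fact (Nat.Prime 2) := ⟨Nat.prime_two⟩
  have h := Equiv.Perm.card_fixedPoints_modEq (f := (σ : Function.End V)) (p := 2) (n := 1)
    (by funext v; exact hσ v)
  have h2 : Fintype.card (Function.fixedPoints (σ : Function.End V)) = #{v | σ v = v} := by
    rw [Fintype.card_subtype]
    rfl
  rw [h2] at h
  rw [Nat.even_iff] at hV ⊢
  exact Eq.trans (Nat.ModEq.symm h) hV

open Classical in
/-- The number of points missed by the matching `σ`, increased by one when no two of them lie on
the same side. -/
noncomputable def potential {V : Type*} [Fintype V] [DecidableEq V] (s : V → Bool)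
    (σ : V → V) : ℕ :=
  #{v | σ v = v} + if ∃ x y, x ≠ y ∧ s x = s y ∧ σ x = x ∧ σ y = y then 0 else 1

section

variable {V : Type*} [Fintype V] [DecidableEq V] {s : V → Bool} {n : ℕ} {σ : V → V}
  {av : V → V → Prop} [∀ u w, Decidable (av u w)] {B : Finset V} {γ : ℕ}

lemma exists_alternating_path (hs : ∀ b, #{v | s v = b} = n) (hσ : Function.Involutive σ)
    (hdeg : ∀ u, n + 2 * γ ≤ 2 * #{z | s z ≠ s u ∧ av u z})
    (hγ : #{v | s (σ v) ≠ s v} + #{v | σ v = v} + 2 * #B < 2 * γ) {x y : V} (hxy : s x = s y) :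
    ∃ z, s z ≠ s x ∧ av x z ∧ s (σ z) ≠ s x ∧ av y (σ z) ∧ σ z ≠ z ∧ z ∉ B ∧ σ z ∉ B := by
  set Z₁ : Finset V := {z | s z ≠ s x ∧ av x z} with hZ₁
  set Z₂ : Finset V := {z | s z ≠ s y ∧ av y z} with hZ₂
  have h1 : n + 2 * γ ≤ 2 * #Z₁ := hdeg x
  have h2 : n + 2 * γ ≤ 2 * #Z₂ := hdeg y
  have hS : #{v | s v ≠ s x} = n := by
    rw [← hs (!(s x))]
    congr 1
    ext v
    simp only [mem_filter, mem_univ, true_and]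
    cases s v <;> cases s x <;> simp
  have himg : #(Z₂.image σ) = #Z₂ := card_image_of_injective _ hσ.injective
  have hun : #(Z₁ ∪ Z₂.image σ) ≤ n + #{v | s (σ v) ≠ s v} := by
    rw [← hS]
    refine (card_le_card ?_).trans (card_union_le _ _)
    intro v hv
    rw [mem_union, mem_filter, mem_filter]
    rcases mem_union.1 hv with h | h
    · left; exact ⟨mem_univ _, (mem_filter.1 h).2.1⟩
    · obtain ⟨z, hz, rfl⟩ := mem_image.1 h
      have := (mem_filter.1 hz).2.1
      by_cases hc : s (σ z) = s x
      · right
        refine ⟨mem_univ _, ?_⟩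
        rw [hσ z, hc, hxy]
        exact this
      · left; exact ⟨mem_univ _, hc⟩
  have hint := card_union_add_card_inter Z₁ (Z₂.image σ)
  have hbad : #(({v | σ v = v} : Finset V) ∪ B ∪ B.image σ) ≤ #{v | σ v = v} + #B + #B :=
    (card_union_le _ _).trans (add_le_add (card_union_le _ _) card_image_le)
  obtain ⟨z, hz, hz'⟩ := exists_mem_notMem_of_card_lt_card
    (s := ({v | σ v = v} : Finset V) ∪ B ∪ B.image σ) (t := Z₁ ∩ Z₂.image σ) (by omega)
  simp only [mem_union, mem_filter, mem_univ, true_and, not_or, mem_image, not_exists,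
    not_and] at hz'
  rw [mem_inter] at hz
  obtain ⟨w, hw, rfl⟩ := mem_image.1 hz.2
  have h3 := (mem_filter.1 hz.1).2
  have h4 := (mem_filter.1 hw).2
  refine ⟨σ w, h3.1, h3.2, ?_, ?_, hz'.1.1, hz'.1.2, ?_⟩
  · rw [hσ w, hxy]; exact h4.1
  · rw [hσ w]; exact h4.2
  · rw [hσ w]; exact fun h => hz'.2 w h rfl

lemma exists_potential_lt (hs : ∀ b, #{v | s v = b} = n) (hσ : Function.Involutive σ)
    (hav : ∀ u w, av u w → av w u)
    (hdeg : ∀ u, n + 2 * γ ≤ 2 * #{z | s z ≠ s u ∧ av u z})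
    (hγ : #{v | s (σ v) ≠ s v} + #{v | σ v = v} + 2 * #B < 2 * γ) {x₀ : V} (hx₀ : σ x₀ = x₀) :
    ∃ (τ : V → V) (x y z z' : V), Function.Involutive τ ∧ σ x = x ∧ σ y = y ∧ z ∉ B ∧ z' ∉ B ∧
      (∀ u, u ≠ x → u ≠ y → u ≠ z → u ≠ z' → τ u = σ u) ∧
      (∀ u w, u ≠ w → τ u = w → σ u = w ∨ av u w) ∧ potential s τ < potential s σ := by
  by_cases hpair : ∃ x y, x ≠ y ∧ s x = s y ∧ σ x = x ∧ σ y = y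
  · obtain ⟨x, y, hne, hxy, hx, hy⟩ := id hpair
    obtain ⟨z, h1, h2, h3, h4, h5, h6, h7⟩ := exists_alternating_path hs hσ hdeg hγ hxy
    have hσz := hσ z
    have hxz : x ≠ z := by rintro rfl; exact h1 rfl
    have hyz : y ≠ z := by rintro rfl; exact h1 hxy.symm
    have hxz' : x ≠ σ z := by intro h; rw [← h] at h3; exact h3 rfl
    have hyz' : y ≠ σ z := by intro h; rw [← h] at h3; exact h3 hxy.symm
    have hc := cut_involutive hσ z
    have hj : Function.Involutive (join (cut σ z) x z) :=
      join_involutive hc (by simp only [cut]; grind) (by simp only [cut]; grind)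
    have hτ : Function.Involutive (join (join (cut σ z) x z) y (σ z)) :=
      join_involutive hj (by simp only [join, cut]; grind) (by simp only [join, cut]; grind)
    refine ⟨_, x, y, z, σ z, hτ, hx, hy, h6, h7, ?_, ?_, ?_⟩
    · intro u e1 e2 e3 e4
      simp [join, cut, e1, e2, e3, e4]
    · intro u w huw hu
      have := hav _ _ h2
      have := hav _ _ h4
      simp only [join, cut] at hu
      grind
    · have hfix : ({v | join (join (cut σ z) x z) y (σ z) v = v} : Finset V) =
          (({v | σ v = v} : Finset V).erase x).erase y := by
        ext v
        simp only [mem_filter, mem_univ, true_and, mem_erase, join, cut]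
        grind
      simp only [potential]
      rw [if_pos hpair, hfix, card_erase_of_mem (by simp [hne.symm, hy]),
        card_erase_of_mem (by simp [hx])]
      have : 2 ≤ #{v | σ v = v} := by
        rw [← card_pair hne]
        apply card_le_card
        intro v hv
        simp only [mem_insert, mem_singleton] at hv
        rcases hv with rfl | rfl <;> simp [hx, hy]
      split_ifs <;> omega
  · have hcardV : Even (Fintype.card V) := by
      have h1 := card_eq_sum_card_fiberwise (s := (univ : Finset V)) (f := s)
        (t := (univ : Finset Bool)) (by simp)
      rw [card_univ] at h1
      rw [h1, Fintype.sum_bool, hs, hs]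
      exact ⟨n, rfl⟩
    obtain ⟨p, hp⟩ := even_card_fixed hσ hcardV
    have hpos : 0 < #{v | σ v = v} := card_pos.2 ⟨x₀, by simpa using hx₀⟩
    obtain ⟨y, hy, hyx⟩ := exists_mem_ne (s := ({v | σ v = v} : Finset V)) (by omega) x₀
    have hy : σ y = y := (mem_filter.1 hy).2
    have hsy : s y ≠ s x₀ := fun h => hpair ⟨y, x₀, hyx, h, hy, hx₀⟩
    obtain ⟨z, h1, h2, h3, -, h5, h6, h7⟩ :=
      exists_alternating_path hs hσ hdeg hγ (rfl : s x₀ = s x₀)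
    have hσz := hσ z
    have hxz : x₀ ≠ z := by rintro rfl; exact h1 rfl
    have hxz' : x₀ ≠ σ z := by intro h; rw [← h] at h3; exact h3 rfl
    have hyz : y ≠ z := by rintro rfl; exact h5 hy
    have hyz' : y ≠ σ z := by rintro rfl; exact h5 (by rw [hσz] at hy; exact hy.symm)
    have hτ : Function.Involutive (join (cut σ z) x₀ z) :=
      join_involutive (cut_involutive hσ z) (by simp only [cut]; grind) (by simp only [cut]; grind)
    refine ⟨_, x₀, x₀, z, σ z, hτ, hx₀, hx₀, h6, h7, ?_, ?_, ?_⟩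
    · intro u e1 e2 e3 e4
      simp [join, cut, e1, e3, e4]
    · intro u w huw hu
      have := hav _ _ h2
      simp only [join, cut] at hu
      grind
    · have hfix : ({v | join (cut σ z) x₀ z v = v} : Finset V) =
          insert (σ z) (({v | σ v = v} : Finset V).erase x₀) := by
        ext v
        simp only [mem_filter, mem_univ, true_and, mem_erase, mem_insert, join, cut]
        grind
      have hpair' : ∃ a b, a ≠ b ∧ s a = s b ∧ join (cut σ z) x₀ z a = a ∧
          join (cut σ z) x₀ z b = b := by
        refine ⟨y, σ z, hyz', ?_, ?_, ?_⟩
        · revert hsy h3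
          cases s y <;> cases s x₀ <;> cases s (σ z) <;> simp
        · simp only [join, cut]; grind
        · simp only [join, cut]; grind
      simp only [potential]
      rw [if_neg hpair, if_pos hpair', hfix, card_insert_of_notMem (by simp [hσz, h5.symm]),
        card_erase_of_mem (by simp [hx₀])]
      omega

end

/-- The number of colours whose edge at `u` stays on the side of `u`. -/
def sameDeg {V : Type*} [DecidableEq V] {k : ℕ} (s : V → Bool) (σ : Fin k → V → V) (u : V) : ℕ :=
  #{i | s (σ i u) = s u ∧ σ i u ≠ u}

section

variable {V : Type*} [Fintype V] [DecidableEq V] {s : V → Bool} {k : ℕ} {σ : Fin k → V → V}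
  {m : V → V → ℕ}

lemma sameDeg_le (hcnt : ∀ u w, u ≠ w → #{i | σ i u = w} ≤ m u w) (u : V) :
    sameDeg s σ u ≤ ∑ w with s w = s u, m u w := by
  have h := card_eq_sum_card_fiberwise
    (s := ({i | s (σ i u) = s u ∧ σ i u ≠ u} : Finset (Fin k))) (f := fun i => σ i u)
    (t := {w | s w = s u}) (by intro i hi; simpa using (mem_filter.1 hi).2.1)
  rw [sameDeg, h]
  refine sum_le_sum fun w _ => ?_
  by_cases huw : u = w
  · subst huw
    have : #{i ∈ ({i | s (σ i u) = s u ∧ σ i u ≠ u} : Finset (Fin k)) | σ i u = u} = 0 := by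
      rw [card_eq_zero, filter_eq_empty_iff]
      intro i hi
      exact (mem_filter.1 hi).2.2
    omega
  · refine le_trans (card_le_card ?_) (hcnt u w huw)
    intro i hi
    simp only [mem_filter, mem_univ, true_and] at hi ⊢
    exact hi.2

lemma degree_le_card_available {r d t : ℕ} (hmult : ∀ u v, m u v ≤ r)
    (hreg : ∀ u, ∑ w, m u w = d) (u : V)
    (hu : ∑ w with s w = s u, m u w ≤ sameDeg s σ u + t) :
    d ≤ r * #{z | s z ≠ s u ∧ #{i | σ i u = z} < m u z} + k + t := by
  have h1 : ∑ w with s w = s u, m u w + ∑ w with s w ≠ s u, m u w = d := by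
    rw [← hreg u, sum_filter_add_sum_filter_not]
  have h2 : #{i | s (σ i u) ≠ s u} = ∑ w with s w ≠ s u, #{i | σ i u = w} := by
    rw [card_eq_sum_card_fiberwise (s := ({i | s (σ i u) ≠ s u} : Finset (Fin k)))
      (f := fun i => σ i u) (t := {w | s w ≠ s u})
      (by intro i hi; simpa using (mem_filter.1 hi).2)]
    refine sum_congr rfl fun w hw => ?_
    congr 1
    ext i
    simp only [mem_filter, mem_univ, true_and] at hw ⊢
    constructor
    · exact fun h => h.2
    · rintro rfl; exact ⟨hw, rfl⟩
  have h3 : sameDeg s σ u + #{i | s (σ i u) ≠ s u} ≤ k := by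
    rw [sameDeg, ← card_union_of_disjoint]
    · simpa using card_le_univ (({i | s (σ i u) = s u ∧ σ i u ≠ u} : Finset (Fin k)) ∪
        ({i | s (σ i u) ≠ s u} : Finset (Fin k)))
    · rw [disjoint_left]
      intro i hi hi'
      exact (mem_filter.1 hi').2 (mem_filter.1 hi).2.1
  have h4 : ∑ w with s w ≠ s u, m u w ≤ ∑ w with s w ≠ s u,
      (#{i | σ i u = w} + if #{i | σ i u = w} < m u w then r else 0) := by
    refine sum_le_sum fun w _ => ?_
    have := hmult u w
    split_ifs <;> omega
  have h5 : ∑ w with s w ≠ s u, (if #{i | σ i u = w} < m u w then r else 0) =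
      r * #{z | s z ≠ s u ∧ #{i | σ i u = z} < m u z} := by
    rw [← sum_filter, filter_filter, sum_const, smul_eq_mul, mul_comm]
  rw [sum_add_distrib, h5] at h4
  omega

/-- An edge colouring of the edges inside the two sides with few missed vertices can be turned
into a family of perfect matchings leaving few of these edges uncoloured. -/
theorem exists_perfect_coloring {n r d t q F β γ : ℕ} (hsym : ∀ u v, m u v = m v u)
    (hmult : ∀ u v, m u v ≤ r) (hreg : ∀ u, ∑ w, m u w = d) (hs : ∀ b, #{v | s v = b} = n)
    (hr : 0 < r) (hσ : ∀ i, Function.Involutive (σ i))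
    (hcnt : ∀ u w, u ≠ w → #{i | σ i u = w} = if s u = s w then m u w else 0)
    (hfix : ∀ i, #{v | σ i v = v} ≤ q) (hF : ∑ i, #{v | σ i v = v} ≤ F)
    (hloop : ∀ v, m v v = 0)
    (hd : r * n + 2 * r * γ + 2 * (k + t) ≤ 2 * d) (hγ : 4 * (q + 1) + 2 * β < 2 * γ)
    (hβ : 2 * (F + k) < t * (β + 1)) :
    ∃ τ : Fin k → V → V, (∀ i, Function.Involutive (τ i)) ∧ (∀ i v, τ i v ≠ v) ∧
      (∀ u w, #{i | τ i u = w} ≤ m u w) ∧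
      (∀ u, ∑ w with s w = s u, m u w ≤ #{i | s (τ i u) = s u} + t) ∧
      ∑ u, ∑ w with s w = s u, m u w ≤ ∑ u, #{i | s (τ i u) = s u} + 2 * (F + k) := by
  suffices h : ∀ (N : ℕ) (σ : Fin k → V → V), (∀ i, Function.Involutive (σ i)) →
      (∀ u w, u ≠ w → #{i | σ i u = w} ≤ m u w) →
      (∀ u, ∑ w with s w = s u, m u w ≤ sameDeg s σ u + t) →
      (∑ u, ∑ w with s w = s u, m u w + 2 * ∑ i, potential s (σ i) ≤
        ∑ u, sameDeg s σ u + 2 * (F + k)) →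
      (∀ i, #{v | s (σ i v) ≠ s v} + 4 * potential s (σ i) ≤ 4 * (q + 1)) →
      ∑ i, potential s (σ i) ≤ N →
      ∃ τ : Fin k → V → V, (∀ i, Function.Involutive (τ i)) ∧ (∀ i v, τ i v ≠ v) ∧
        (∀ u w, #{i | τ i u = w} ≤ m u w) ∧
        (∀ u, ∑ w with s w = s u, m u w ≤ #{i | s (τ i u) = s u} + t) ∧
        ∑ u, ∑ w with s w = s u, m u w ≤ ∑ u, #{i | s (τ i u) = s u} + 2 * (F + k) by
    have hsame : ∀ i v, s (σ i v) = s v := by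
      intro i v
      by_contra hne
      have h1 := hcnt v (σ i v) (fun h => hne (by rw [← h]))
      rw [if_neg (Ne.symm hne), card_eq_zero, filter_eq_empty_iff] at h1
      exact h1 (mem_univ i) rfl
    have hdeg : ∀ u, ∑ w with s w = s u, m u w = sameDeg s σ u := by
      intro u
      rw [sameDeg, card_eq_sum_card_fiberwise (f := fun i => σ i u) (t := {w | s w = s u})
        (by intro i hi; simpa using (mem_filter.1 hi).2.1)]
      refine sum_congr rfl fun w hw => ?_
      have hw : s w = s u := (mem_filter.1 hw).2
      rw [filter_filter]
      by_cases huw : u = w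
      · subst huw
        rw [hloop, eq_comm, card_eq_zero, filter_eq_empty_iff]
        rintro i - ⟨h1, h2⟩
        exact h1.2 h2
      · have := hcnt u w huw
        rw [if_pos hw.symm] at this
        rw [← this]
        congr 1
        ext i
        simp only [mem_filter, mem_univ, true_and, hsame, true_and]
        constructor
        · rintro rfl; exact ⟨Ne.symm huw, rfl⟩
        · exact fun h => h.2
    have hpot : ∀ i, potential s (σ i) ≤ #{v | σ i v = v} + 1 := by
      intro i
      simp only [potential]
      split_ifs <;> omega
    have hpotsum : ∑ i, potential s (σ i) ≤ F + k := by
      calc _ ≤ ∑ i, (#{v | σ i v = v} + 1) := sum_le_sum fun i _ => hpot i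
        _ ≤ F + k := by simp only [sum_add_distrib]; simpa using hF
    refine h _ σ hσ ?_ (fun u => by rw [hdeg]; omega) ?_ ?_ le_rfl
    · intro u w huw
      rw [hcnt u w huw]
      split_ifs <;> simp
    · simp only [hdeg]
      omega
    · intro i
      have : #{v | s (σ i v) ≠ s v} = 0 := by simp [hsame]
      have := hpot i
      have := hfix i
      omega
  clear hF hfix hcnt hσ
  intro N
  induction N using Nat.strong_induction_on with
  | _ N ih =>
  intro σ hσ hcnt hH hsum hcross hN
  by_cases hfree : ∀ i v, σ i v ≠ v
  · have hsd : ∀ u, sameDeg s σ u = #{i | s (σ i u) = s u} := by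
      intro u
      simp [sameDeg, hfree]
    refine ⟨σ, hσ, hfree, ?_, ?_, ?_⟩
    · intro u w
      by_cases huw : u = w
      · subst huw; simp [hfree]
      · exact hcnt u w huw
    · simpa only [hsd] using hH
    · simp only [hsd] at hsum
      omega
  push Not at hfree
  obtain ⟨i, x₀, hx₀⟩ := hfree
  let B : Finset V := {u | sameDeg s σ u + t ≤ ∑ w with s w = s u, m u w}
  have hB : #B ≤ β := by
    have h1 : ∑ u, (sameDeg s σ u + if u ∈ B then t else 0) ≤
        ∑ u, ∑ w with s w = s u, m u w := by
      refine sum_le_sum fun u _ => ?_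
      split_ifs with hu
      · exact (mem_filter.1 hu).2
      · exact sameDeg_le hcnt u
    rw [sum_add_distrib] at h1
    simp only [sum_ite_mem, univ_inter, sum_const, smul_eq_mul] at h1
    have h2 : t * #B < t * (β + 1) := by
      rw [mul_comm] at h1
      omega
    have := lt_of_mul_lt_mul_left h2 (Nat.zero_le _)
    omega
  have hsymc : ∀ u w, #{i | σ i u = w} = #{i | σ i w = u} := by
    intro u w
    congr 1
    ext i
    simp only [mem_filter, mem_univ, true_and]
    exact ⟨fun h => by rw [← h, hσ], fun h => by rw [← h, hσ]⟩
  obtain ⟨τ, x, y, z, z', hτ, hx, hy, hz, hz', hτσ, hτav, hlt⟩ :=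
    exists_potential_lt (s := s) (n := n) (σ := σ i) (B := B) (γ := γ)
      (av := fun u w => #{i | σ i u = w} < m u w) hs (hσ i)
      (fun u w h => by rw [hsymc w u, hsym w u]; exact h)
      (by
        intro u
        have h1 := degree_le_card_available hmult hreg u (hH u)
        refine le_of_mul_le_mul_left ?_ hr
        nlinarith)
      (by
        have h1 := hcross i
        have h2 : #{v | σ i v = v} ≤ potential s (σ i) := by simp [potential]
        omega) hx₀
  have hui : Function.update σ i τ i = τ := Function.update_self ..
  have huj : ∀ j, j ≠ i → Function.update σ i τ j = σ j := fun j hj =>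
    Function.update_of_ne hj ..
  have hsd : ∀ u, sameDeg s σ u ≤ sameDeg s (Function.update σ i τ) u +
      if u = z ∨ u = z' then 1 else 0 := by
    intro u
    split_ifs with hu
    · rw [sameDeg, sameDeg]
      refine le_trans (card_le_card ?_) (card_insert_le i _)
      intro j hj
      by_cases hji : j = i
      · simp [hji]
      · simpa [hji, huj j hji] using hj
    · rw [sameDeg, sameDeg, add_zero]
      push Not at hu
      refine card_le_card ?_
      intro j hj
      by_cases hji : j = i
      · subst hji
        simp only [mem_filter, mem_univ, true_and, hui] at hj ⊢
        rw [hτσ u (by rintro rfl; exact hj.2 hx) (by rintro rfl; exact hj.2 hy) hu.1 hu.2]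
        exact hj
      · simpa [huj j hji] using hj
  have hpsum : ∑ j, potential s (Function.update σ i τ j) < ∑ j, potential s (σ j) := by
    refine sum_lt_sum (fun j _ => ?_) ⟨i, mem_univ _, by rw [hui]; exact hlt⟩
    by_cases hji : j = i
    · subst hji; rw [hui]; exact hlt.le
    · rw [huj j hji]
  refine ih _ (lt_of_lt_of_le hpsum hN) (Function.update σ i τ) ?_ ?_ ?_ ?_ ?_ le_rfl
  · intro j
    by_cases hji : j = i
    · subst hji; rw [hui]; exact hτ
    · rw [huj j hji]; exact hσ j
  · intro u w huw
    by_cases h : τ u = w ∧ σ i u ≠ w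
    · have h1 := (hτav u w huw h.1).resolve_left h.2
      refine le_trans (card_le_card (t := insert i ({i | σ i u = w} : Finset (Fin k))) ?_)
        ((card_insert_le _ _).trans h1)
      intro j hj
      by_cases hji : j = i
      · simp [hji]
      · simpa [hji, huj j hji] using hj
    · refine le_trans (card_le_card ?_) (hcnt u w huw)
      intro j hj
      by_cases hji : j = i
      · subst hji
        simp only [mem_filter, mem_univ, true_and, hui] at hj ⊢
        tauto
      · simpa [huj j hji] using hj
  · intro u
    have h1 := hsd u
    have h2 := hH u
    split_ifs at h1 with hu
    · have h3 : u ∉ B := by rcases hu with rfl | rfl <;> assumption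
      simp only [B, mem_filter, mem_univ, true_and] at h3
      omega
    · omega
  · have h1 := sum_le_sum fun u (_ : u ∈ univ) => hsd u
    rw [sum_add_distrib] at h1
    have h2 : ∑ u, (if u = z ∨ u = z' then 1 else 0) ≤ 2 := by
      rw [← card_filter]
      refine le_trans (card_le_card ?_) (card_le_two (a := z) (b := z'))
      intro u hu
      simpa using hu
    omega
  · intro j
    by_cases hji : j = i
    · subst hji
      rw [hui]
      have h1 := hcross j
      have h2 : #{v | s (τ v) ≠ s v} ≤ #{v | s (σ j v) ≠ s v} + 4 := by
        have h3 : ({v | s (τ v) ≠ s v} : Finset V) ⊆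
            ({v | s (σ j v) ≠ s v} : Finset V) ∪ {x, y, z, z'} := by
          intro v hv
          simp only [mem_filter, mem_univ, true_and, mem_union, mem_insert,
            mem_singleton] at hv ⊢
          by_contra! hcon
          rw [hτσ v hcon.2.1 hcon.2.2.1 hcon.2.2.2.1 hcon.2.2.2.2] at hv
          exact hv hcon.1
        exact (card_le_card h3).trans ((card_union_le _ _).trans
          (Nat.add_le_add_left card_le_four _))
      omega
    · rw [huj j hji]; exact hcross j

end

lemma card_filter_update {α : Type*} {k : ℕ} (ν : Fin k → α) (j : Fin k) (τ : α) (P : α → Prop)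
    [DecidablePred P] :
    #{i | P (Function.update ν j τ i)} + (if P (ν j) then 1 else 0) =
      #{i | P (ν i)} + if P τ then 1 else 0 := by
  rw [card_filter, card_filter, ← add_sum_erase univ _ (mem_univ j),
    ← add_sum_erase univ (fun i => if P (ν i) then 1 else 0) (mem_univ j), Function.update_self,
    sum_congr rfl (fun i hi => by rw [Function.update_of_ne (ne_of_mem_erase hi)] :
      ∀ i ∈ univ.erase j, (if P (Function.update ν j τ i) then 1 else 0) =
        if P (ν i) then 1 else 0)]
  ring

lemma join_side {V : Type*} [DecidableEq V] {s : V → Bool} {σ : V → V} {x y : V}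
    (hs : s x = s y) (u : V) :
    s (join σ x y u) = if u = x ∨ u = y then s u else s (σ u) := by
  simp only [join]
  grind

section

variable {V : Type*} [Fintype V] [DecidableEq V] {s : V → Bool}

lemma card_moved_join {σ : V → V} {x y : V} (hx : σ x = x) (hy : σ y = y) (hxy : x ≠ y)
    (hs : s x = s y) (c : Bool) :
    #{v | s v = c ∧ join σ x y v ≠ v} = #{v | s v = c ∧ σ v ≠ v} + if s x = c then 2 else 0 := by
  split_ifs with hc
  · have : univ.filter (fun v => s v = c ∧ join σ x y v ≠ v) =
        insert x (insert y (univ.filter fun v => s v = c ∧ σ v ≠ v)) := by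
      ext v
      simp only [mem_filter, mem_univ, true_and, mem_insert, join]
      grind
    rw [this, card_insert_of_notMem (by simp [hx, hxy]), card_insert_of_notMem (by simp [hy])]
  · rw [add_zero]
    congr 1
    ext v
    simp only [mem_filter, mem_univ, true_and, join]
    grind

lemma card_moved_eq_sum {k : ℕ} {ν : Fin k → V → V} {h : V → V → ℕ} (hloop : ∀ v, h v v = 0)
    (hcnt : ∀ u w, u ≠ w → #{i | ν i u = w} = h u w) (u : V) :
    #{i | ν i u ≠ u} = ∑ w, h u w := by
  rw [card_eq_sum_card_fiberwise (s := ({i | ν i u ≠ u} : Finset (Fin k))) (f := fun i => ν i u)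
    (t := univ) (by simp)]
  refine sum_congr rfl fun w _ => ?_
  by_cases huw : u = w
  · subst huw
    rw [hloop, card_eq_zero, filter_eq_empty_iff]
    exact fun i hi => (mem_filter.1 hi).2
  · rw [← hcnt u w huw, filter_filter]
    congr 1
    ext i
    simp only [mem_filter, mem_univ, true_and]
    exact ⟨fun h => h.2, fun h => ⟨h ▸ Ne.symm huw, h⟩⟩

/-- A sparse multigraph with no edges across the two sides and with equally many edges on each side
can be coloured so that every colour class is small and covers equally many vertices on each
side. -/
theorem exists_paired_coloring {T L t ℓ : ℕ} (hℓ : 4 * t + L ≤ ℓ) (x : ℕ) :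
    ∀ h : V → V → ℕ, (∀ u v, h u v = h v u) → (∀ v, h v v = 0) →
      (∀ u w, h u w ≠ 0 → s u = s w) → (∀ u, ∑ w, h u w ≤ t) →
      (∀ c, ∑ u with s u = c, ∑ w, h u w = x) → x < T * L →
      ∃ ν : Fin ℓ → V → V, (∀ j, Function.Involutive (ν j)) ∧ (∀ j u, s (ν j u) = s u) ∧
        (∀ u w, u ≠ w → #{j | ν j u = w} = h u w) ∧
        (∀ j, #{v | s v = true ∧ ν j v ≠ v} = #{v | s v = false ∧ ν j v ≠ v}) ∧
        ∀ j, #{v | s v = true ∧ ν j v ≠ v} ≤ T + 1 := by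
  induction x using Nat.strong_induction_on with
  | _ x ih =>
  intro h hsym hloop hside hdeg hx hxT
  rcases Nat.eq_zero_or_pos x with rfl | hpos
  · refine ⟨fun _ => id, fun _ _ => rfl, fun _ _ => rfl, ?_, by simp, by simp⟩
    intro u w huw
    have h1 := hx (s u)
    rw [sum_eq_zero_iff] at h1
    have h2 := sum_eq_zero_iff.1 (h1 u (by simp)) w (mem_univ w)
    simp [huw, h2]
  have hedge : ∀ c, ∃ a a', s a = c ∧ h a a' ≠ 0 := by
    intro c
    by_contra! hne
    have : ∑ u with s u = c, ∑ w, h u w = 0 := sum_eq_zero fun u hu =>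
      sum_eq_zero fun w _ => hne u w (mem_filter.1 hu).2
    have := hx c
    omega
  obtain ⟨a, a', ha, haa⟩ := hedge true
  obtain ⟨b, b', hb, hbb⟩ := hedge false
  have ha' := (hside a a' haa).symm.trans ha
  have hb' := (hside b b' hbb).symm.trans hb
  have hna : a ≠ a' := fun h => haa (h ▸ hloop a)
  have hnb : b ≠ b' := fun h => hbb (h ▸ hloop b)
  let e : V → V → ℕ := fun u w => ((if u = a then if w = a' then 1 else 0 else 0) +
    if u = a' then if w = a then 1 else 0 else 0) +
    ((if u = b then if w = b' then 1 else 0 else 0) +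
    if u = b' then if w = b then 1 else 0 else 0)
  have heh : ∀ u w, e u w ≤ h u w := by
    intro u w
    have h1 := hsym a a'
    have h2 := hsym b b'
    simp only [e]
    grind
  have hesym : ∀ u w, e u w = e w u := by
    intro u w
    simp only [e]
    grind
  have hesum : ∀ u, ∑ w, e u w = ((if u = a then 1 else 0) + if u = a' then 1 else 0) +
      ((if u = b then 1 else 0) + if u = b' then 1 else 0) := by
    intro u
    simp only [e, sum_add_distrib]
    congr 1 <;> congr 1 <;> split_ifs <;> simp
  have hetot : ∀ c, ∑ u with s u = c, ∑ w, e u w = 2 := by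
    intro c
    simp only [hesum, sum_add_distrib, sum_ite_eq', mem_filter, mem_univ, true_and]
    cases c <;> simp [ha, ha', hb, hb']
  have hsub : ∀ u, ∑ w, (h u w - e u w) + ∑ w, e u w = ∑ w, h u w := by
    intro u
    rw [← sum_add_distrib]
    exact sum_congr rfl fun w _ => Nat.sub_add_cancel (heh u w)
  have hsubtot : ∀ c, ∑ u with s u = c, ∑ w, (h u w - e u w) = x - 2 := by
    intro c
    have h1 := hx c
    rw [sum_congr rfl fun u _ => (hsub u).symm, sum_add_distrib, hetot] at h1
    omega
  have hx2 : 2 ≤ x := by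
    have h1 := hx true
    rw [sum_congr rfl fun u _ => (hsub u).symm, sum_add_distrib, hetot] at h1
    omega
  obtain ⟨ν, hν, hνs, hνcnt, hνeq, hνT⟩ := ih (x - 2) (by omega) (fun u w => h u w - e u w)
    (fun u w => by rw [hsym u w, hesym u w]) (fun v => by rw [hloop, Nat.zero_sub])
    (fun u w hne => hside u w (by omega))
    (fun u => le_trans (by have := hsub u; omega) (hdeg u)) hsubtot (by omega)
  have hmoved := fun u => card_moved_eq_sum (fun v => by rw [hloop, Nat.zero_sub]) hνcnt u
  have hbad : ∀ u, #{i | ν i u ≠ u} ≤ t := fun u => by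
    have := hsub u
    have := hdeg u
    rw [hmoved]
    omega
  have hfull : #{j | T ≤ #{v | s v = true ∧ ν j v ≠ v}} < L := by
    have h1 : #{j | T ≤ #{v | s v = true ∧ ν j v ≠ v}} * T ≤
        ∑ j, #{v | s v = true ∧ ν j v ≠ v} := by
      rw [← smul_eq_mul]
      exact (card_nsmul_le_sum _ _ _ fun j hj => (mem_filter.1 hj).2).trans
        (sum_le_sum_of_subset (filter_subset _ _))
    have h2 : ∑ j, #{v | s v = true ∧ ν j v ≠ v} = x - 2 := by
      rw [← hsubtot true, ← sum_congr rfl fun u _ => hmoved u]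
      simp only [← filter_filter, card_filter _ (filter _ _), card_filter _ univ]
      exact sum_comm
    have h3 : T * #{j | T ≤ #{v | s v = true ∧ ν j v ≠ v}} < T * L := by
      rw [mul_comm]
      omega
    exact lt_of_mul_lt_mul_left h3 (Nat.zero_le _)
  obtain ⟨j, hj⟩ : ∃ j, ν j a = a ∧ ν j a' = a' ∧ ν j b = b ∧ ν j b' = b' ∧
      #{v | s v = true ∧ ν j v ≠ v} < T := by
    by_contra! hne
    let Z : V → Finset (Fin ℓ) := fun u => {i | ν i u ≠ u}
    let Y : Finset (Fin ℓ) := {j | T ≤ #{v | s v = true ∧ ν j v ≠ v}}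
    have hcov : (univ : Finset (Fin ℓ)) ⊆ (Z a ∪ Z a') ∪ (Z b ∪ Z b') ∪ Y := by
      intro i _
      have := hne i
      simp only [mem_union, mem_filter, mem_univ, true_and, Z, Y]
      tauto
    have h1 := card_le_card hcov
    rw [card_univ, Fintype.card_fin] at h1
    have h2 := card_union_le ((Z a ∪ Z a') ∪ (Z b ∪ Z b')) Y
    have h3 := card_union_le (Z a ∪ Z a') (Z b ∪ Z b')
    have h4 := card_union_le (Z a) (Z a')
    have h5 := card_union_le (Z b) (Z b')
    have h6 : #(Z a) ≤ t := hbad a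
    have h7 : #(Z a') ≤ t := hbad a'
    have h8 : #(Z b) ≤ t := hbad b
    have h9 : #(Z b') ≤ t := hbad b'
    have h10 : #Y < L := hfull
    omega
  obtain ⟨ja, ja', jb, jb', jT⟩ := hj
  have hab : ∀ {u v}, s u = true → s v = false → u ≠ v := by
    rintro u v h1 h2 rfl
    simp [h1] at h2
  have ka : join (ν j) a a' b = b := by rw [join_of_ne (hab ha hb).symm (hab ha' hb).symm, jb]
  have ka' : join (ν j) a a' b' = b' := by
    rw [join_of_ne (hab ha hb').symm (hab ha' hb').symm, jb']
  have hmv : ∀ c, #{v | s v = c ∧ join (join (ν j) a a') b b' v ≠ v} =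
      #{v | s v = c ∧ ν j v ≠ v} + 2 := by
    intro c
    rw [card_moved_join ka ka' hnb (hside b b' hbb), card_moved_join ja ja' hna (hside a a' haa),
      ha, hb]
    cases c <;> simp
  refine ⟨Function.update ν j (join (join (ν j) a a') b b'), ?_, ?_, ?_, ?_, ?_⟩
  · intro i
    by_cases hij : i = j
    · subst hij
      rw [Function.update_self]
      exact join_involutive (join_involutive (hν i) ja ja') ka ka'
    · rw [Function.update_of_ne hij]
      exact hν i
  · intro i u
    by_cases hij : i = j
    · subst hij
      rw [Function.update_self]
      rw [join_side (hb.trans hb'.symm), join_side (ha.trans ha'.symm), hνs, ite_self, ite_self]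
    · rw [Function.update_of_ne hij]
      exact hνs i u
  · intro u w huw
    have h1 := card_filter_update ν j (join (join (ν j) a a') b b') (fun f => f u = w)
    rw [hνcnt u w huw] at h1
    have h2 : (if join (join (ν j) a a') b b' u = w then 1 else 0) =
        (if ν j u = w then 1 else 0) + e u w := by
      simp only [e, join]
      grind
    have := heh u w
    omega
  · intro i
    by_cases hij : i = j
    · subst hij
      rw [Function.update_self, hmv, hmv, hνeq]
    · rw [Function.update_of_ne hij]
      exact hνeq i
  · intro i
    by_cases hij : i = j
    · subst hij
      rw [Function.update_self, hmv]
      omega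
    · rw [Function.update_of_ne hij]
      exact hνT i

end

lemma sum_sub_matching {V : Type*} [DecidableEq V] {m : V → V → ℕ} {π : V → V}
    (hpos : ∀ u, 0 < m u (π u)) (u : V) (S : Finset V) :
    ∑ w ∈ S, m u w = ∑ w ∈ S, (m u w - if π u = w then 1 else 0) + if π u ∈ S then 1 else 0 := by
  have : (if π u ∈ S then 1 else 0) = ∑ w ∈ S, if π u = w then 1 else 0 := by simp
  rw [this, ← sum_add_distrib]
  refine sum_congr rfl fun w _ => ?_
  have := hpos u
  split_ifs with h
  · subst h; omega
  · rfl

lemma sub_matching_symm {V : Type*} [DecidableEq V] {m : V → V → ℕ} {π : V → V}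
    (hπ : Function.Involutive π) (hsym : ∀ u v, m u v = m v u)
    (u v : V) : (m u v - if π u = v then 1 else 0) = m v u - if π v = u then 1 else 0 := by
  have : π u = v ↔ π v = u := ⟨fun h => by rw [← h, hπ], fun h => by rw [← h, hπ]⟩
  simp [this, hsym u v]

section

variable {V : Type*} [Fintype V] [DecidableEq V] {s : V → Bool} {m : V → V → ℕ}

/-- If Hall's condition holds between the fixed points of an involution on the two sides, then the
involution extends to a perfect matching. -/
theorem exists_matching_extension {ν : V → V} (hν : Function.Involutive ν)
    (hsym : ∀ u v, m u v = m v u)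
    (heq : #{v | s v = true ∧ ν v = v} = #{v | s v = false ∧ ν v = v})
    (hall : ∀ X : Finset V, (∀ v ∈ X, s v = true ∧ ν v = v) →
      #X ≤ #{w | (s w = false ∧ ν w = w) ∧ ∃ v ∈ X, 0 < m v w}) :
    ∃ π : V → V, Function.Involutive π ∧ (∀ u, ν u ≠ u → π u = ν u) ∧
      ∀ u, ν u = u → s (π u) ≠ s u ∧ 0 < m u (π u) := by
  let P := {v // s v = true ∧ ν v = v}
  let Q := {v // s v = false ∧ ν v = v}
  let nb : P → Finset Q := fun p => {q | 0 < m p.1 q.1}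
  obtain ⟨f, hf, hfnb⟩ := (all_card_le_biUnion_card_iff_exists_injective nb).1 (by
    intro X
    have h1 := hall (X.map (Function.Embedding.subtype _)) (by
      intro v hv
      obtain ⟨p, -, rfl⟩ := mem_map.1 hv
      exact p.2)
    rw [card_map] at h1
    refine h1.trans ?_
    rw [← card_map (Function.Embedding.subtype _) (s := X.biUnion nb)]
    refine card_le_card fun w hw => ?_
    obtain ⟨hw, v, hv, hvw⟩ := (mem_filter.1 hw).2
    obtain ⟨p, hp, rfl⟩ := mem_map.1 hv
    exact mem_map.2 ⟨⟨w, hw⟩, mem_biUnion.2 ⟨p, hp, mem_filter.2 ⟨mem_univ _, hvw⟩⟩, rfl⟩)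
  have hcard : Fintype.card P = Fintype.card Q := by
    rw [Fintype.card_subtype, Fintype.card_subtype, heq]
  let e : P ≃ Q := Equiv.ofBijective f ((Fintype.bijective_iff_injective_and_card f).2 ⟨hf, hcard⟩)
  have he : ∀ p, 0 < m p.1 (e p).1 := fun p => (mem_filter.1 (hfnb p)).2
  let π : V → V := fun u => if h : s u = true ∧ ν u = u then (e ⟨u, h⟩).1 else
    if h : s u = false ∧ ν u = u then (e.symm ⟨u, h⟩).1 else ν u
  have hπP : ∀ p : P, π p.1 = (e p).1 := fun p => by simp only [π]; rw [dif_pos p.2]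
  have hπQ : ∀ q : Q, π q.1 = (e.symm q).1 := fun q => by
    simp only [π]
    rw [dif_neg (by simp [q.2.1]), dif_pos q.2]
  have hπν : ∀ u, ν u ≠ u → π u = ν u := fun u hu => by simp [π, hu]
  refine ⟨π, fun u => ?_, hπν, fun u hu => ?_⟩
  · by_cases hu : ν u = u
    · cases hsu : s u
      · have h1 := hπQ ⟨u, hsu, hu⟩
        simp only at h1
        rw [h1, hπP, e.apply_symm_apply]
      · have h1 := hπP ⟨u, hsu, hu⟩
        simp only at h1
        rw [h1, hπQ, e.symm_apply_apply]
    · rw [hπν u hu, hπν (ν u) (by rw [hν]; exact Ne.symm hu), hν]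
  · cases hsu : s u
    · have h1 := hπQ ⟨u, hsu, hu⟩
      have h2 := he (e.symm ⟨u, hsu, hu⟩)
      rw [e.apply_symm_apply] at h2
      simp only at h1 h2
      rw [h1, hsym]
      exact ⟨by simp [(e.symm ⟨u, hsu, hu⟩).2.1], h2⟩
    · have h1 := hπP ⟨u, hsu, hu⟩
      simp only at h1
      rw [h1]
      exact ⟨by simp [(e ⟨u, hsu, hu⟩).2.1], he ⟨u, hsu, hu⟩⟩

/-- Removing perfect matchings reduces 1-factorizability to the remaining multigraph. -/
theorem oneFactorizable_of_sub {k : ℕ} {τ : Fin k → V → V} (hτ : ∀ i, Function.Involutive (τ i))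
    (hle : ∀ u w, #{i | τ i u = w} ≤ m u w)
    (h : OneFactorizable fun u w => m u w - #{i | τ i u = w}) : OneFactorizable m := by
  obtain ⟨k', F, hF, hsum⟩ := h
  refine ⟨k + k', Fin.append (fun i u w => if τ i u = w then 1 else 0) F, ?_, ?_⟩
  · intro i
    refine Fin.addCases (fun i => ?_) (fun i => ?_) i
    · rw [Fin.append_left]
      refine ⟨fun u v => ?_, fun u v => ?_, fun v => by simp⟩
      · have : τ i u = v ↔ τ i v = u :=
          ⟨fun h => by rw [← h, hτ], fun h => by rw [← h, hτ]⟩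
        simp [this]
      · dsimp only
        split_ifs with huv
        · refine le_trans ?_ (hle u v)
          exact card_pos.2 ⟨i, by simp [huv]⟩
        · exact Nat.zero_le _
    · rw [Fin.append_right]
      exact ⟨(hF i).1, fun u v => ((hF i).2.1 u v).trans (Nat.sub_le _ _), (hF i).2.2⟩
  · intro u v
    have := hle u v
    rw [Fin.sum_univ_add]
    simp only [Fin.append_left, Fin.append_right, hsum, sum_boole, Nat.cast_id]
    omega

lemma oneFactorizable_of_sub_one {π : V → V} (hπ : Function.Involutive π)
    (hpos : ∀ u, 0 < m u (π u))
    (h : OneFactorizable fun u w => m u w - if π u = w then 1 else 0) : OneFactorizable m := by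
  refine oneFactorizable_of_sub (k := 1) (τ := fun _ => π) (fun _ => hπ) (fun u w => ?_) ?_
  · by_cases huw : π u = w
    · subst huw
      simpa using Nat.succ_le_of_lt (hpos u)
    · simp [huw]
  · convert h using 4
    split_ifs with h <;> simp [h]

/-- **Kőnig's theorem** for regular bipartite multigraphs. -/
theorem oneFactorizable_of_bipartite {n : ℕ} (hs : ∀ b, #{v | s v = b} = n) (d : ℕ) :
    ∀ m : V → V → ℕ, (∀ u v, m u v = m v u) → (∀ u w, s u = s w → m u w = 0) →
      (∀ u, ∑ w, m u w = d) → OneFactorizable m := by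
  induction d with
  | zero =>
    intro m _ _ hreg
    refine ⟨0, Fin.elim0, fun i => i.elim0, fun u v => ?_⟩
    have := sum_eq_zero_iff.1 (hreg u) v (mem_univ v)
    simp [this]
  | succ d ih =>
    intro m hsym hside hreg
    obtain ⟨π, hπ, -, hπ2⟩ := exists_matching_extension (s := s) (ν := id) (m := m)
      (fun _ => rfl) hsym (by simp [hs]) (by
        intro X hX
        set N : Finset V := {w | (s w = false ∧ id w = w) ∧ ∃ v ∈ X, 0 < m v w} with hN
        have h1 : ∑ v ∈ X, ∑ w, m v w = ∑ v ∈ X, ∑ w ∈ N, m v w := by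
          refine sum_congr rfl fun v hv => (sum_subset (subset_univ N) fun w _ hw => ?_).symm
          by_contra hne
          refine hw (mem_filter.2 ⟨mem_univ _, ⟨?_, rfl⟩, v, hv, Nat.pos_of_ne_zero hne⟩)
          have h2 : s v ≠ s w := fun h => hne (hside v w h)
          rw [(hX v hv).1] at h2
          simpa using h2.symm
        have h2 : ∑ v ∈ X, ∑ w ∈ N, m v w ≤ ∑ w ∈ N, ∑ v, m w v := by
          rw [sum_comm]
          refine sum_le_sum fun w _ => ?_
          simp only [hsym w]
          exact sum_le_sum_of_subset (subset_univ X)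
        rw [← h1] at h2
        simp only [hreg, sum_const, smul_eq_mul] at h2
        exact Nat.le_of_mul_le_mul_right h2 (Nat.succ_pos d))
    have hpos : ∀ u, 0 < m u (π u) := fun u => (hπ2 u rfl).2
    refine oneFactorizable_of_sub_one hπ hpos (ih _ (sub_matching_symm hπ hsym) ?_ ?_)
    · intro u w huw
      rw [hside u w huw, Nat.zero_sub]
    · intro u
      have := sum_sub_matching hpos u univ
      rw [hreg, if_pos (mem_univ _)] at this
      omega

/-- A multigraph whose edges inside the two sides are partitioned into small matchings, and which
is dense enough across, is 1-factorizable. -/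
theorem oneFactorizable_of_paired_coloring {n r T : ℕ} (hr : 0 < r)
    (hs : ∀ b, #{v | s v = b} = n) (ℓ : ℕ) :
    ∀ (d : ℕ) (m : V → V → ℕ) (ν : Fin ℓ → V → V), (∀ u v, m u v = m v u) → (∀ v, m v v = 0) →
      (∀ u v, m u v ≤ r) → (∀ u, ∑ w, m u w = d) →
      (∀ j, Function.Involutive (ν j)) → (∀ j u, s (ν j u) = s u) →
      (∀ u w, u ≠ w → s u = s w → #{j | ν j u = w} = m u w) →
      (∀ j, #{v | s v = true ∧ ν j v ≠ v} = #{v | s v = false ∧ ν j v ≠ v}) →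
      (∀ j, #{v | s v = true ∧ ν j v ≠ v} ≤ T) →
      (∀ u, r * n + 2 * r * T + 2 * ℓ ≤ 2 * ∑ w with s w ≠ s u, m u w) →
      OneFactorizable m := by
  induction ℓ with
  | zero =>
    intro d m ν hsym hloop _ hreg _ _ hcnt _ _ _
    refine oneFactorizable_of_bipartite hs d m hsym (fun u w h => ?_) hreg
    by_cases huw : u = w
    · rw [huw, hloop]
    · rw [← hcnt u w huw h]
      simp
  | succ ℓ ih =>
    intro d m ν hsym hloop hmult hreg hν hνs hcnt hνeq hνT hcross
    have hfix : ∀ c, #{v | s v = c ∧ ν 0 v = v} + #{v | s v = c ∧ ν 0 v ≠ v} = n := by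
      intro c
      rw [← hs c, ← card_filter_add_card_filter_not (s := {v | s v = c}) (fun v => ν 0 v = v),
        filter_filter, filter_filter]
    have heq : #{v | s v = true ∧ ν 0 v = v} = #{v | s v = false ∧ ν 0 v = v} := by
      have := hfix true
      have := hfix false
      have := hνeq 0
      omega
    have hdense : ∀ u c, s u ≠ c →
        #{v | s v = c ∧ ν 0 v = v} ≤ 2 * #{v | (s v = c ∧ ν 0 v = v) ∧ 0 < m u v} := by
      intro u c huc
      have h1 : ∑ w with s w ≠ s u, m u w ≤ r * #{v | s v = c ∧ 0 < m u v} := by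
        have h2 : ∑ w with s w ≠ s u, m u w = ∑ w with s w = c ∧ 0 < m u w, m u w := by
          rw [sum_filter, sum_filter]
          refine sum_congr rfl fun w _ => ?_
          have h3 : s w ≠ s u ↔ s w = c := by
            have : ∀ x y z : Bool, y ≠ z → (x ≠ y ↔ x = z) := by decide
            exact this _ _ _ huc
          simp only [h3]
          by_cases h4 : s w = c <;> simp [h4]
        rw [h2, mul_comm, ← smul_eq_mul]
        exact sum_le_card_nsmul _ _ _ fun w _ => hmult u w
      have h2 : n + 2 * T ≤ 2 * #{v | s v = c ∧ 0 < m u v} := by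
        have := hcross u
        refine Nat.le_of_mul_le_mul_left ?_ hr
        nlinarith
      have h3 : #{v | s v = c ∧ 0 < m u v} ≤
          #{v | (s v = c ∧ ν 0 v = v) ∧ 0 < m u v} + #{v | s v = c ∧ ν 0 v ≠ v} := by
        refine le_trans (card_le_card ?_) (card_union_le _ _)
        intro v
        simp only [mem_filter, mem_univ, true_and, mem_union]
        tauto
      have h4 : #{v | s v = c ∧ ν 0 v ≠ v} ≤ T := by
        have := hνT 0
        have := hνeq 0
        cases c <;> omega
      have := hfix c
      omega
    obtain ⟨π, hπ, hπν, hπ2⟩ := exists_matching_extension (hν 0) hsym heq (by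
      intro X hX
      set N : Finset V := {w | (s w = false ∧ ν 0 w = w) ∧ ∃ v ∈ X, 0 < m v w} with hN
      rcases X.eq_empty_or_nonempty with rfl | ⟨x, hx⟩
      · simp
      have h1 : #{v | (s v = false ∧ ν 0 v = v) ∧ 0 < m x v} ≤ #N := by
        refine card_le_card fun w hw => ?_
        have hw := (mem_filter.1 hw).2
        exact mem_filter.2 ⟨mem_univ _, hw.1, x, hx, hw.2⟩
      have h2 := hdense x false (by simp [(hX x hx).1])
      have hXc : X ⊆ univ.filter (fun v => s v = true ∧ ν 0 v = v) := fun v hv =>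
        mem_filter.2 ⟨mem_univ _, hX v hv⟩
      by_cases hall : ∀ w, s w = false ∧ ν 0 w = w → w ∈ N
      · refine (card_le_card hXc).trans (heq.le.trans (card_le_card fun w hw => hall w ?_))
        exact (mem_filter.1 hw).2
      · push Not at hall
        obtain ⟨w, hw, hwN⟩ := hall
        have h3 := hdense w true (by simp [hw.1])
        have h4 : Disjoint X (univ.filter fun v => (s v = true ∧ ν 0 v = v) ∧ 0 < m w v) := by
          rw [disjoint_left]
          intro v hv hv'
          refine hwN (mem_filter.2 ⟨mem_univ _, hw, v, hv, ?_⟩)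
          rw [hsym]
          exact (mem_filter.1 hv').2.2
        have h5 : #(X ∪ univ.filter fun v => (s v = true ∧ ν 0 v = v) ∧ 0 < m w v) ≤
            #{v | s v = true ∧ ν 0 v = v} := by
          refine card_le_card (union_subset hXc fun v hv => ?_)
          exact mem_filter.2 ⟨mem_univ _, (mem_filter.1 hv).2.1⟩
        rw [card_union_of_disjoint h4] at h5
        omega)
    have hpos : ∀ u, 0 < m u (π u) := by
      intro u
      by_cases hu : ν 0 u = u
      · exact (hπ2 u hu).2
      · rw [hπν u hu, ← hcnt u (ν 0 u) (Ne.symm hu) (hνs 0 u).symm]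
        exact card_pos.2 ⟨0, by simp⟩
    refine oneFactorizable_of_sub_one hπ hpos (ih (d - 1) _ (fun j => ν j.succ)
      (sub_matching_symm hπ hsym) (fun v => by rw [hloop, Nat.zero_sub])
      (fun u v => (Nat.sub_le _ _).trans (hmult u v)) ?_ (fun j => hν _) (fun j => hνs _) ?_
      (fun j => hνeq _) (fun j => hνT _) ?_)
    · intro u
      have := sum_sub_matching hpos u univ
      rw [hreg, if_pos (mem_univ _)] at this
      omega
    · intro u w huw hsuw
      have h1 := hcnt u w huw hsuw
      rw [Fin.card_filter_univ_succ] at h1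
      have h2 : π u = w ↔ ν 0 u = w := by
        by_cases hu : ν 0 u = u
        · rw [hu]
          exact ⟨fun h => absurd (h ▸ hsuw.symm) (hπ2 u hu).1, fun h => absurd h huw⟩
        · rw [hπν u hu]
      simp only [h2]
      split_ifs at h1 ⊢ <;> omega
    · intro u
      have h1 := sum_sub_matching hpos u {w | s w ≠ s u}
      have h2 := hcross u
      split_ifs at h1 <;> omega

end

/-- In a regular multigraph with two sides of equal size, both sides span equally many edges. -/
lemma sum_same_side_eq {V : Type*} [Fintype V] {s : V → Bool} {m : V → V → ℕ} {n d : ℕ}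
    (hs : ∀ b, #{v | s v = b} = n) (hsym : ∀ u v, m u v = m v u)
    (hreg : ∀ u, ∑ w, m u w = d) (c : Bool) :
    ∑ u with s u = c, ∑ w with s w = s u, m u w =
      ∑ u with s u = true, ∑ w with s w = s u, m u w := by
  have h1 : ∀ c, ∑ u with s u = c, ∑ w with s w = s u, m u w +
      ∑ u with s u = c, ∑ w with s w = !c, m u w = n * d := by
    intro c
    rw [← sum_add_distrib, ← hs c, ← smul_eq_mul, ← sum_const]
    refine sum_congr rfl fun u hu => ?_
    have hu : s u = c := (mem_filter.1 hu).2
    rw [← hreg u, ← sum_filter_add_sum_filter_not univ (fun w => s w = s u), hu]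
    congr 2
    ext w
    simp [Bool.eq_not]
  have h2 : ∑ u with s u = true, ∑ w with s w = false, m u w =
      ∑ u with s u = false, ∑ w with s w = true, m u w := by
    rw [sum_comm]
    simp only [hsym]
  have h3 := h1 true
  have h4 := h1 false
  simp only [Bool.not_true, Bool.not_false] at h3 h4
  cases c
  · omega
  · rfl

section

variable {V : Type*} [Fintype V] [DecidableEq V] {s : V → Bool} {m : V → V → ℕ}

lemma sum_card_fixed_le {k g : ℕ} {σ : Fin k → V → V} (h : ∀ v, #{i | σ i v = v} ≤ g) :
    ∑ i, #{v | σ i v = v} ≤ Fintype.card V * g := by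
  simp only [card_filter _ univ] at h ⊢
  rw [sum_comm, ← card_univ, ← smul_eq_mul]
  exact sum_le_card_nsmul _ _ _ fun v _ => h v

/-- The combinatorial core: a dense regular multigraph with two equal sides, whose degrees inside
the sides are almost constant, is 1-factorizable. -/
theorem oneFactorizable_of_bounds {n r d Δ D W : ℕ} (hr : 0 < r) (hn : 0 < n)
    (hs : ∀ b, #{v | s v = b} = n) (hsym : ∀ u v, m u v = m v u) (hloop : ∀ v, m v v = 0)
    (hmult : ∀ u v, m u v ≤ r) (hreg : ∀ u, ∑ w, m u w = d)
    (hΔ : ∀ u, ∑ w with s w = s u, m u w ≤ Δ) (hΔr : Δ ≤ r * n) (hΔn : r * n ≤ 2 * Δ)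
    (hD : ∀ u, Δ ≤ ∑ w with s w = s u, m u w + D)
    (hd : r * n + 28 * (r * W) + 2 * Δ ≤ 2 * d) (hDW : 28 * D ≤ W + 1)
    (hnD : 100 * (n * D) ≤ 101 * (W * W)) (hnW : 1000 * n ≤ W * W) (hW : 1000 ≤ W) :
    OneFactorizable m := by
  have hV : Fintype.card V = 2 * n := by
    rw [← card_univ, ← card_filter_add_card_filter_not (fun v => s v = true)]
    simp only [Bool.not_eq_true, hs]
    ring
  have hrW : W ≤ r * W := Nat.le_mul_of_pos_left W hr
  have hrr : r * 1000 ≤ r * W := Nat.mul_le_mul_left r hW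
  have hrWW : W * W ≤ r * (W * W) := Nat.le_mul_of_pos_left _ hr
  have hrnW : 1000 * (r * n) ≤ r * (W * W) := by
    have := Nat.mul_le_mul_left r hnW
    linarith
  have hrWW2 : 1000 * (r * W) ≤ r * (W * W) := by
    have := Nat.mul_le_mul_left (r * W) hW
    linarith
  obtain ⟨σ, hσ, hσcnt, hσbal⟩ := exists_balanced_edgeColoring
    (m := fun u w => if s u = s w then m u w else 0) (r := r) (Δ := Δ)
    (fun u v => by simp only [hsym u v, eq_comm])
    (fun u v => by split_ifs; exacts [hmult u v, Nat.zero_le _])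
    (fun u => by
      rw [← sum_filter]
      simpa only [eq_comm] using hΔ u)
  have hσfix : ∀ v, #{i | σ i v = v} ≤ D + r := by
    intro v
    have h1 := card_moved_eq_sum (fun v => by simp [hloop]) hσcnt v
    rw [← sum_filter] at h1
    have h2 := card_filter_add_card_filter_not (s := univ) (fun i => σ i v = v)
    rw [card_univ, Fintype.card_fin] at h2
    have h3 := hD v
    simp only [eq_comm (a := s v)] at h1
    simp only [ne_eq] at h1
    omega
  have hF := sum_card_fixed_le hσfix
  rw [hV] at hF
  have hq : ∀ i, #{v | σ i v = v} ≤ 4 * D + 6 := by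
    intro i
    have h1 : (Δ + r) * #{v | σ i v = v} ≤ ∑ j, (#{v | σ j v = v} + 2) := by
      have := card_nsmul_le_sum univ (fun j => #{v | σ j v = v} + 2) _ fun j _ => hσbal i j
      simpa using this
    rw [sum_add_distrib, sum_const, card_univ, Fintype.card_fin, smul_eq_mul] at h1
    by_contra! hlt
    have h2 : (Δ + r) * (4 * D + 7) ≤ (Δ + r) * #{v | σ i v = v} := Nat.mul_le_mul_left _ hlt
    have h3 : r * n * (4 * D + 5) ≤ 2 * (Δ + r) * (4 * D + 5) :=
      Nat.mul_le_mul_right _ (by omega)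
    have h4 : n * (r * (4 * D + 5)) ≤ n * (4 * (D + r)) := by linarith
    have h5 := Nat.le_of_mul_le_mul_left h4 hn
    have h6 : D ≤ r * D := Nat.le_mul_of_pos_left D hr
    linarith
  have hFk : 2 * n * (D + r) + (Δ + r) ≤ 3 * (r * (W * W)) := by
    nlinarith
  obtain ⟨τ, hτ, hτfree, hτle, hτdeg, hτsum⟩ := exists_perfect_coloring (s := s) (n := n) (d := d)
    (t := r * W) (β := 5 * W) (γ := 12 * W) hsym hmult hreg hs hr hσ hσcnt hq hF hloop
    (by linarith) (by omega) (by linarith)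
  refine oneFactorizable_of_sub hτ hτle ?_
  set m' : V → V → ℕ := fun u w => m u w - #{i | τ i u = w} with hm'
  have hsub : ∀ u (S : Finset V), ∑ w ∈ S, m u w = ∑ w ∈ S, m' u w + #{i | τ i u ∈ S} := by
    intro u S
    rw [card_eq_sum_card_fiberwise (s := ({i | τ i u ∈ S} : Finset _)) (f := fun i => τ i u)
      (t := S) (by intro i hi; simpa using hi), ← sum_add_distrib]
    refine sum_congr rfl fun w hw => ?_
    have h1 : ({i ∈ ({i | τ i u ∈ S} : Finset _) | τ i u = w}) =
        univ.filter (fun i => τ i u = w) := by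
      ext i
      simp only [mem_filter, mem_univ, true_and, and_iff_right_iff_imp]
      rintro rfl
      exact hw
    rw [h1]
    have := hτle u w
    simp only [hm']
    omega
  have hsym' : ∀ u v, m' u v = m' v u := by
    intro u v
    have : ∀ i, τ i u = v ↔ τ i v = u := fun i =>
      ⟨fun h => by rw [← h, hτ], fun h => by rw [← h, hτ]⟩
    simp only [hm', this, hsym u v]
  have hloop' : ∀ v, m' v v = 0 := fun v => by simp only [hm', hloop, Nat.zero_sub]
  have hreg' : ∀ u, ∑ w, m' u w = d - (Δ + r) := by
    intro u
    have := hsub u univ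
    simp only [mem_univ, filter_true, card_univ, Fintype.card_fin, hreg] at this
    omega
  have hsame : ∀ u, ∑ w with s w = s u, m u w =
      ∑ w with s w = s u, m' u w + #{i | s (τ i u) = s u} := by
    intro u
    simpa using hsub u {w | s w = s u}
  have hdeg' : ∀ u, ∑ w with s w = s u, m' u w ≤ r * W := fun u => by
    have := hsame u
    have := hτdeg u
    omega
  have hx : ∑ u with s u = true, ∑ w with s w = s u, m' u w < 2 * W * (3 * (r * W)) := by
    have h1 : ∑ u, ∑ w with s w = s u, m' u w ≤ 2 * (2 * n * (D + r) + (Δ + r)) := by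
      simp only [hsame, sum_add_distrib] at hτsum
      omega
    rw [← sum_filter_add_sum_filter_not univ (fun u => s u = true)] at h1
    simp only [Bool.not_eq_true] at h1
    rw [sum_same_side_eq hs hsym' hreg' false] at h1
    have : 0 < r * (W * W) := by positivity
    linarith
  obtain ⟨ν, hν, hνs, hνcnt, hνeq, hνT⟩ := exists_paired_coloring (s := s) (t := r * W)
    (le_refl (4 * (r * W) + 3 * (r * W))) _ (fun u w => if s w = s u then m' u w else 0)
    (fun u v => by simp only [hsym' u v, eq_comm]) (fun v => by simp [hloop'])
    (fun u w h => by
      by_contra hne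
      exact h (if_neg (Ne.symm hne)))
    (fun u => by rw [← sum_filter]; exact hdeg' u)
    (fun c => by
      simp only [← sum_filter _ _]
      exact sum_same_side_eq hs hsym' hreg' c) hx
  refine oneFactorizable_of_paired_coloring hr hs _ _ m' ν hsym' hloop'
    (fun u v => (Nat.sub_le _ _).trans (hmult u v)) hreg' hν hνs ?_ hνeq hνT ?_
  · intro u w huw hsuw
    rw [hνcnt u w huw, if_pos hsuw.symm]
  · intro u
    have h1 := hreg' u
    rw [← sum_filter_add_sum_filter_not univ (fun w => s w = s u)] at h1
    have h2 := hdeg' u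
    have h3 : 2 * (Δ + r) + 2 * (r * W) ≤ 2 * d := by linarith
    have h4 : d = (d - (Δ + r)) + (Δ + r) := by omega
    simp only [ne_eq]
    linarith

end

end OneFactorization

/-- Let `G` be a regular multigraph of order `2n` with multiplicity at most `r`,
where `n^(5/6) > 3r`.  Suppose the vertex set is partitioned into two equal parts
`A` and `B` such that every vertex `v` has `d_A(v) > rn/2 + 14·r·n^(5/6)` and
`d_B(v) > rn/2 + 14·r·n^(5/6)`, and
`max{Δ(G_A), Δ(G_B)} − min{δ(G_A), δ(G_B)} < n^(2/3)` (expressed here as: the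
difference of the within-own-part degrees of any two vertices is less than
`n^(2/3)`).  Then `G` is 1-factorizable. -/
theorem one_factorization_of_balanced_partition
    (n r : ℕ) (hr : 0 < r) (hnr : 3 * (r : ℝ) < (n : ℝ) ^ ((5 : ℝ) / 6))
    (V : Type) [Fintype V] [DecidableEq V] (hcard : Fintype.card V = 2 * n)
    (m : V → V → ℕ)
    (hsym : ∀ u v, m u v = m v u) (hloop : ∀ v, m v v = 0)
    (hmult : ∀ u v, m u v ≤ r)
    (d : ℕ) (hreg : ∀ v, mDeg m v = d)
    (A B : Finset V) (hdisj : Disjoint A B) (hunion : A ∪ B = Finset.univ)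
    (hA : A.card = n) (hB : B.card = n)
    (hdA : ∀ v : V,
      (r : ℝ) * n / 2 + 14 * r * (n : ℝ) ^ ((5 : ℝ) / 6) < ∑ x ∈ A, (m v x : ℝ))
    (hdB : ∀ v : V,
      (r : ℝ) * n / 2 + 14 * r * (n : ℝ) ^ ((5 : ℝ) / 6) < ∑ x ∈ B, (m v x : ℝ))
    (hbal : ∀ u v : V,
      (if u ∈ A then ∑ x ∈ A, (m u x : ℝ) else ∑ x ∈ B, (m u x : ℝ)) -
        (if v ∈ A then ∑ x ∈ A, (m v x : ℝ) else ∑ x ∈ B, (m v x : ℝ)) <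
        (n : ℝ) ^ ((2 : ℝ) / 3)) :
    OneFactorizable m := by
  classical
  let s : V → Bool := fun v => decide (v ∈ A)
  have hsA : Finset.univ.filter (fun v => s v = true) = A := by ext v; simp [s]
  have hsB : Finset.univ.filter (fun v => s v = false) = B := by
    ext v
    have h1 : v ∈ A ∪ B := hunion ▸ Finset.mem_univ v
    have h2 : v ∈ A → v ∉ B := fun h => Finset.disjoint_left.1 hdisj h
    have h3 := Finset.mem_union.1 h1
    simp only [s, Finset.mem_filter, Finset.mem_univ, true_and, decide_eq_false_iff_not]
    tauto
  have hs : ∀ b, (Finset.univ.filter fun v => s v = b).card = n := by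
    rintro (_ | _)
    · rw [hsB, hB]
    · rw [hsA, hA]
  let dH : V → ℕ := fun u => ∑ w with s w = s u, m u w
  have hdH : ∀ u, (dH u : ℝ) = if u ∈ A then ∑ x ∈ A, (m u x : ℝ) else ∑ x ∈ B, (m u x : ℝ) := by
    intro u
    by_cases hu : u ∈ A
    · have : s u = true := by simp [s, hu]
      simp only [dH, if_pos hu, this, hsA, Nat.cast_sum]
    · have : s u = false := by simp [s, hu]
      simp only [dH, if_neg hu, this, hsB, Nat.cast_sum]
  have hdC : ∀ u, (d : ℝ) - dH u =
      if u ∈ A then ∑ x ∈ B, (m u x : ℝ) else ∑ x ∈ A, (m u x : ℝ) := by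
    intro u
    have h1 : (d : ℝ) = ∑ x ∈ A, (m u x : ℝ) + ∑ x ∈ B, (m u x : ℝ) := by
      rw [← hreg u, mDeg, ← hunion, Finset.sum_union hdisj]
      push_cast
      rfl
    rw [hdH]
    split_ifs <;> linarith
  have hn : 0 < n := by
    rcases Nat.eq_zero_or_pos n with rfl | h
    · rw [Nat.cast_zero, Real.zero_rpow (by norm_num)] at hnr
      have : (0 : ℝ) ≤ r := Nat.cast_nonneg r
      linarith
    · exact h
  have hnR : (0 : ℝ) < n := by exact_mod_cast hn
  have hrR : (1 : ℝ) ≤ r := by exact_mod_cast hr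
  obtain ⟨M, hM0, hM6, hM5, hM4⟩ : ∃ M : ℝ, 0 < M ∧ (n : ℝ) = M ^ 6 ∧
      (n : ℝ) ^ ((5 : ℝ) / 6) = M ^ 5 ∧ (n : ℝ) ^ ((2 : ℝ) / 3) = M ^ 4 := by
    refine ⟨(n : ℝ) ^ ((1 : ℝ) / 6), by positivity, ?_, ?_, ?_⟩ <;>
    · rw [← Real.rpow_natCast, ← Real.rpow_mul hnR.le]
      norm_num
  rw [hM5] at hdA hdB
  rw [hM4] at hbal
  have hne : (Finset.univ : Finset V).Nonempty := by
    rw [← Finset.card_pos, Finset.card_univ, hcard]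
    omega
  obtain ⟨a, -, ha⟩ := Finset.exists_max_image Finset.univ dH hne
  obtain ⟨b, -, hb⟩ := Finset.exists_min_image Finset.univ dH hne
  have hlow : (r : ℝ) * n / 2 + 14 * r * M ^ 5 < dH a := by
    rw [hdH]
    split_ifs
    exacts [hdA a, hdB a]
  have hcross : (r : ℝ) * n / 2 + 14 * r * M ^ 5 < d - dH a := by
    rw [hdC]
    split_ifs
    exacts [hdB a, hdA a]
  have hΔr : dH a ≤ r * n := by
    rw [← hs (s a), mul_comm, ← smul_eq_mul]
    exact Finset.sum_le_card_nsmul _ _ _ fun w _ => hmult a w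
  have hDR : ((dH a - dH b : ℕ) : ℝ) < M ^ 4 := by
    rw [Nat.cast_sub (ha b (Finset.mem_univ b)), hdH, hdH]
    exact hbal a b
  have hM28 : 28 < M := by
    have h1 : (dH a : ℝ) ≤ r * n := by exact_mod_cast hΔr
    have h2 : (r : ℝ) * M ^ 5 * 28 < r * M ^ 5 * M := by
      rw [hM6] at h1 hlow
      nlinarith
    exact lt_of_mul_lt_mul_left h2 (by positivity)
  have hM4' : (28 : ℝ) ^ 4 < M ^ 4 := by gcongr
  have hM45 : 28 * M ^ 4 < M ^ 5 := by
    have : 0 < M ^ 4 := by positivity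
    nlinarith
  have hW1 : (⌊M ^ 5⌋₊ : ℝ) ≤ M ^ 5 := Nat.floor_le (by positivity)
  have hW2 : M ^ 5 < ⌊M ^ 5⌋₊ + 1 := Nat.lt_floor_add_one _
  set W := ⌊M ^ 5⌋₊
  have hWbig : (1000 : ℝ) ≤ W := by
    norm_num at hM4'
    linarith
  have hsq : M ^ 10 ≤ ((W : ℝ) + 1) * (W + 1) := by
    have h1 : M ^ 10 = M ^ 5 * M ^ 5 := by ring
    rw [h1]
    exact mul_le_mul hW2.le hW2.le (by positivity) (by positivity)
  have hrW : (r : ℝ) * W ≤ r * M ^ 5 := by gcongr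
  refine OneFactorization.oneFactorizable_of_bounds (s := s) (Δ := dH a) (D := dH a - dH b) (W := W)
    hr hn hs hsym hloop hmult hreg (fun u => ha u (Finset.mem_univ u)) hΔr ?_ ?_ ?_ ?_ ?_ ?_ ?_
  · have h1 : (r * n : ℝ) ≤ 2 * dH a := by
      have : 0 ≤ (r : ℝ) * M ^ 5 := by positivity
      linarith
    exact_mod_cast h1
  · intro u
    have h1 : dH b ≤ dH u := hb u (Finset.mem_univ u)
    change dH a ≤ dH u + (dH a - dH b)
    omega
  · have h1 : (r * n + 28 * (r * W) + 2 * dH a : ℝ) ≤ 2 * d := by linarith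
    exact_mod_cast h1
  · have h1 : (28 * (dH a - dH b : ℕ) : ℝ) ≤ W + 1 := by linarith
    exact_mod_cast h1
  · have h1 : (100 * (n * (dH a - dH b : ℕ)) : ℝ) ≤ 101 * (W * W) := by
      have h2 : (n : ℝ) * (dH a - dH b : ℕ) ≤ M ^ 10 := by
        have h3 : M ^ 10 = M ^ 6 * M ^ 4 := by ring
        rw [hM6, h3]
        gcongr
      nlinarith
    exact_mod_cast h1
  · have h1 : (1000 * n : ℝ) ≤ W * W := by
      have h2 : 28 ^ 4 * M ^ 6 ≤ M ^ 10 := by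
        have h3 : M ^ 10 = M ^ 4 * M ^ 6 := by ring
        rw [h3]
        gcongr
      rw [hM6]
      norm_num at h2
      nlinarith
    exact_mod_cast h1
  · exact_mod_cast hWbig
end

section
/- For every positive integer r there exists an integer N = N(r) such that for all n ≥ N, the vertex set of any multigraph G of order 2n with multiplicity at most r can be partitioned into two parts A and B with |A| = |B| = n such that every vertex v of G satisfies |d_A(v) − d_B(v)| < √(n · log n). -/
/-- The sign `±1` attached to a Boolean. -/
def boolSign (b : Bool) : ℤ := if b then 1 else -1

theorem boolSign_not (b : Bool) : boolSign (!b) = -boolSign b := by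
  cases b <;> simp [boolSign]

theorem sum_exp_signed_sum_le {ι : Type*} [Fintype ι] [DecidableEq ι] (a : ι → ℝ) (s : ℝ) :
    ∑ x : ι → Bool, Real.exp (s * ∑ i, (boolSign (x i) : ℝ) * a i) ≤
      2 ^ Fintype.card ι * Real.exp (s ^ 2 * (∑ i, a i ^ 2) / 2) := by
  have h1 : ∑ x : ι → Bool, Real.exp (s * ∑ i, (boolSign (x i) : ℝ) * a i) =
      ∏ i, ∑ b : Bool, Real.exp (s * ((boolSign b : ℝ) * a i)) := by
    rw [Finset.prod_univ_sum]
    simp only [Fintype.piFinset_univ]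
    refine Finset.sum_congr rfl fun x _ => ?_
    rw [Finset.mul_sum, Real.exp_sum]
  have h2 : ∀ i, ∑ b : Bool, Real.exp (s * ((boolSign b : ℝ) * a i)) ≤
      2 * Real.exp ((s * a i) ^ 2 / 2) := by
    intro i
    have := Real.cosh_le_exp_half_sq (s * a i)
    rw [Real.cosh_eq] at this
    simp only [Fintype.sum_bool, boolSign]
    norm_num
    linarith
  rw [h1]
  refine (Finset.prod_le_prod (fun i _ => by positivity) fun i _ => h2 i).trans_eq ?_
  rw [Finset.prod_mul_distrib, ← Real.exp_sum, Finset.prod_const, Finset.card_univ]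
  congr 2
  rw [Finset.mul_sum, Finset.sum_div]
  exact Finset.sum_congr rfl fun i _ => by ring

/-- Hoeffding's inequality for signed sums, in counting form. -/
theorem card_le_abs_signed_sum_le {ι : Type*} [Fintype ι] [DecidableEq ι] (a : ι → ℝ)
    {S t : ℝ} (hS : 0 < S) (ht : 0 ≤ t) (ha : ∑ i, a i ^ 2 ≤ S) :
    ((Finset.univ.filter fun x : ι → Bool =>
        t ≤ |∑ i, (boolSign (x i) : ℝ) * a i|).card : ℝ) ≤
      2 * 2 ^ Fintype.card ι * Real.exp (-(t ^ 2 / (2 * S))) := by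
  set X : (ι → Bool) → ℝ := fun x => ∑ i, (boolSign (x i) : ℝ) * a i with hX
  set s := t / S with hs
  have hs0 : 0 ≤ s := by positivity
  have key : ((Finset.univ.filter fun x : ι → Bool => t ≤ |X x|).card : ℝ) * Real.exp (s * t) ≤
      2 * 2 ^ Fintype.card ι * Real.exp (s ^ 2 * S / 2) := by
    have hmono : ∀ u : ℝ, u ^ 2 = s ^ 2 → ∑ x, Real.exp (u * X x) ≤
        2 ^ Fintype.card ι * Real.exp (s ^ 2 * S / 2) := by
      intro u hu
      refine (sum_exp_signed_sum_le a u).trans ?_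
      rw [hu]
      gcongr
    calc _ = ∑ x ∈ Finset.univ.filter fun x : ι → Bool => t ≤ |X x|, Real.exp (s * t) := by
          rw [Finset.sum_const, nsmul_eq_mul]
      _ ≤ ∑ x ∈ Finset.univ.filter fun x : ι → Bool => t ≤ |X x|,
            (Real.exp (s * X x) + Real.exp (-s * X x)) := by
          refine Finset.sum_le_sum fun x hx => ?_
          have hx := (Finset.mem_filter.1 hx).2
          have : Real.exp (s * t) ≤ Real.exp (s * |X x|) := by gcongr
          refine this.trans ?_
          rcases abs_cases (X x) with ⟨h, _⟩ | ⟨h, _⟩ <;> rw [h]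
          · linarith [Real.exp_pos (-s * X x)]
          · rw [mul_neg, ← neg_mul]
            linarith [Real.exp_pos (s * X x)]
      _ ≤ ∑ x, (Real.exp (s * X x) + Real.exp (-s * X x)) :=
          Finset.sum_le_sum_of_subset_of_nonneg (Finset.subset_univ _)
            fun _ _ _ => by positivity
      _ ≤ _ := by
          rw [Finset.sum_add_distrib]
          linarith [hmono s rfl, hmono (-s) (by ring)]
  have e : Real.exp (-(t ^ 2 / (2 * S))) * Real.exp (s * t) = Real.exp (s ^ 2 * S / 2) := by
    rw [← Real.exp_add]
    congr 1
    rw [hs]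
    field_simp
    ring
  rw [← e, ← mul_assoc] at key
  exact le_of_mul_le_mul_right key (Real.exp_pos _)

theorem add_mul_add_le_of_ratio_le {H₀ H₁ a₀ a₁ D E : ℝ} (hH₀ : 0 ≤ H₀) (ha₁ : 0 ≤ a₁)
    (ha : a₁ ≤ a₀) (hE : 1 ≤ E)
    (h00 : H₀ * a₀ ≤ D) (h11 : H₁ * a₁ ≤ D) (h10 : H₁ * a₀ ≤ E * D) :
    (H₀ + H₁) * (a₀ + a₁) ≤ (2 + E + E⁻¹) * D := by
  have hE0 : 0 < E := by linarith
  have hD : 0 ≤ D := le_trans (mul_nonneg hH₀ (ha₁.trans ha)) h00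
  rcases eq_or_lt_of_le (ha₁.trans ha) with h0 | h0
  · have : a₁ = 0 := by linarith
    rw [← h0, this]
    have : 0 ≤ (2 + E + E⁻¹) * D := by positivity
    simpa using this
  obtain ⟨u, rfl⟩ : ∃ u, a₁ = u * a₀ := ⟨a₁ / a₀, by field_simp⟩
  have hu0 : 0 ≤ u := nonneg_of_mul_nonneg_left ha₁ h0
  have hu1 : u ≤ 1 := by
    by_contra! h
    nlinarith
  have hEi : E⁻¹ * E = 1 := inv_mul_cancel₀ hE0.ne'
  have A : H₀ * a₀ * (1 + u) ≤ D * (1 + u) := by gcongr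
  rcases le_total u E⁻¹ with h | h
  · have B : H₁ * a₀ * (1 + u) ≤ E * D * (1 + u) := by gcongr
    have C : (1 + E) * D * (1 + u) ≤ (1 + E) * D * (1 + E⁻¹) := by gcongr
    nlinarith
  · have hup : 0 < u := lt_of_lt_of_le (by positivity) h
    have hui : u⁻¹ * u = 1 := inv_mul_cancel₀ hup.ne'
    have B : H₁ * (u * a₀) * (1 + u⁻¹) ≤ D * (1 + u⁻¹) := by gcongr
    have B' : H₁ * (u * a₀) * (1 + u⁻¹) = H₁ * a₀ * (1 + u) := by field_simp; ring
    have hiE : u⁻¹ ≤ E := by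
      rw [← inv_inv E]
      gcongr
    have hprod : u + u⁻¹ ≤ E + E⁻¹ := by
      have h3 : 0 ≤ (u - E⁻¹) * (E - u) := mul_nonneg (by linarith) (by linarith)
      have h4 : (u - E⁻¹) * (E - u) = u * (E + E⁻¹ - u - u⁻¹) := by
        linear_combination -hEi + hui
      rw [h4] at h3
      have := nonneg_of_mul_nonneg_right h3 hup
      linarith
    have C : (u + u⁻¹) * D ≤ (E + E⁻¹) * D := by gcongr
    nlinarith

/-- Isoperimetry in the discrete cube: a function growing at most exponentially in the Hamming
distance from a large set has small average. -/
theorem sum_mul_card_le_of_le_exp_hammingDist {l : ℝ} (hl : 0 ≤ l) (n : ℕ)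
    (A : Finset (Fin n → Bool)) (h : (Fin n → Bool) → ℝ) (h0 : ∀ x, 0 ≤ h x)
    (hA : ∀ x, ∀ y ∈ A, h x ≤ Real.exp (l * hammingDist x y)) :
    (∑ x, h x) * A.card ≤ (2 + Real.exp l + (Real.exp l)⁻¹) ^ n := by
  induction n with
  | zero =>
    rcases A.eq_empty_or_nonempty with rfl | ⟨y, hy⟩
    · simp
    · have hy' : A = {y} := Finset.eq_singleton_iff_unique_mem.2
        ⟨hy, fun z _ => Subsingleton.elim _ _⟩
      have := hA y y hy
      simp at this
      rw [hy', Fintype.sum_subsingleton h y]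
      simpa using this
  | succ n ih =>
    set C := 2 + Real.exp l + (Real.exp l)⁻¹ with hC
    set H : Bool → ℝ := fun b => ∑ x, h (Fin.cons b x) with hH
    set P : Bool → Finset (Fin n → Bool) :=
      fun b => Finset.univ.filter fun x => (Fin.cons b x : Fin (n + 1) → Bool) ∈ A with hP
    have hsum : ∀ f : (Fin (n + 1) → Bool) → ℝ,
        ∑ x, f x = ∑ x, f (Fin.cons false x) + ∑ x, f (Fin.cons true x) := by
      intro f
      rw [← (Fin.consEquiv fun _ => Bool).sum_comp, Fintype.sum_prod_type, Fintype.sum_bool,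
        add_comm]
      rfl
    have hcard : (A.card : ℝ) = (P false).card + (P true).card := by
      have e : (A.card : ℝ) = ∑ x, if x ∈ A then (1 : ℝ) else 0 := by simp
      rw [e, hsum]
      simp [hP]
    have hdist : ∀ (b c : Bool) (x y : Fin n → Bool),
        hammingDist (Fin.cons b x : Fin (n + 1) → Bool) (Fin.cons c y) =
          (if b = c then 0 else 1) + hammingDist x y := by
      intro b c x y
      simp only [hammingDist, Finset.card_filter, Fin.sum_univ_succ, Fin.cons_zero, Fin.cons_succ]
      by_cases hbc : b = c <;> simp [hbc]
    have hsame : ∀ b, H b * (P b).card ≤ C ^ n := by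
      intro b
      refine ih (P b) (fun x => h (Fin.cons b x)) (fun x => h0 _) fun x y hy => ?_
      have := hA (Fin.cons b x) _ (Finset.mem_filter.1 hy).2
      rw [hdist] at this
      simpa using this
    have hdiff : ∀ b c, b ≠ c → H b * (P c).card ≤ Real.exp l * C ^ n := by
      intro b c hbc
      have := ih (P c) (fun x => Real.exp (-l) * h (Fin.cons b x))
        (fun x => mul_nonneg (Real.exp_pos _).le (h0 _)) fun x y hy => by
          have := hA (Fin.cons b x) _ (Finset.mem_filter.1 hy).2
          rw [hdist, if_neg hbc] at this
          calc _ ≤ Real.exp (-l) * _ := mul_le_mul_of_nonneg_left this (Real.exp_pos _).le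
            _ = _ := by
              rw [← Real.exp_add]
              congr 1
              push_cast
              ring
      rw [← Finset.mul_sum] at this
      calc _ = Real.exp l * (Real.exp (-l) * H b * (P c).card) := by
            rw [Real.exp_neg]
            field_simp
        _ ≤ _ := mul_le_mul_of_nonneg_left this (Real.exp_pos _).le
    have hH0 : ∀ b, 0 ≤ H b := fun b => Finset.sum_nonneg fun x _ => h0 _
    have hE : 1 ≤ Real.exp l := Real.one_le_exp hl
    rw [hsum h, hcard, pow_succ, mul_comm (C ^ n)]
    rcases le_total ((P true).card : ℝ) (P false).card with hle | hle
    · exact add_mul_add_le_of_ratio_le (hH0 false) (Nat.cast_nonneg _) hle hE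
        (hsame _) (hsame _) (hdiff _ _ (by simp))
    · rw [add_comm (∑ x, h (Fin.cons false x)), add_comm ((P false).card : ℝ)]
      exact add_mul_add_le_of_ratio_le (hH0 true) (Nat.cast_nonneg _) hle hE
        (hsame _) (hsame _) (hdiff _ _ (by simp))

/-- A large subset of the discrete cube contains two points that are nearly antipodal. -/
theorem exists_card_agree_le {n : ℕ} (A : Finset (Fin n → Bool)) {ε δ : ℝ} (hε : 0 ≤ ε)
    (hδ : 2 * δ < ε ^ 2 * n) (hA : 2 ^ n * Real.exp (-δ) ≤ A.card) :
    ∃ x ∈ A, ∃ y ∈ A, ((Finset.univ.filter fun i => x i = y i).card : ℝ) ≤ ε * n := by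
  by_contra! hcon
  set neg : (Fin n → Bool) → (Fin n → Bool) := fun x i => !(x i) with hneg
  have hinv : ∀ x, neg (neg x) = x := fun x => by ext i; simp [hneg]
  have key := sum_mul_card_le_of_le_exp_hammingDist (l := 2 * ε) (by positivity) n A
    (fun x => if neg x ∈ A then Real.exp (2 * ε * (ε * n)) else 0)
    (fun x => by positivity) fun x y hy => by
      split_ifs with hx
      · have := hcon _ hx y hy
        have e : hammingDist x y = (Finset.univ.filter fun i => neg x i = y i).card := by
          simp only [hammingDist, hneg]
          congr 1
          ext i
          simp only [Finset.mem_filter, Finset.mem_univ, true_and]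
          cases x i <;> cases y i <;> simp
        rw [e]
        gcongr
      · positivity
  have hcard : (Finset.univ.filter fun x => neg x ∈ A).card = A.card := by
    refine Finset.card_bij (fun x _ => neg x) (fun x hx => (Finset.mem_filter.1 hx).2)
      (fun x _ y _ h => by rw [← hinv x, h, hinv]) fun y hy => ⟨neg y, ?_, hinv y⟩
    simpa [hinv] using hy
  rw [← Finset.sum_filter, Finset.sum_const, hcard, nsmul_eq_mul] at key
  have hC : 2 + Real.exp (2 * ε) + (Real.exp (2 * ε))⁻¹ ≤ 4 * Real.exp (ε ^ 2) := by
    have h1 := Real.cosh_le_exp_half_sq ε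
    have h2 : (Real.cosh ε) ^ 2 ≤ Real.exp (ε ^ 2 / 2) ^ 2 := by
      have := Real.cosh_pos ε
      gcongr
    rw [← Real.exp_nat_mul] at h2
    have h3 : 2 + Real.exp (2 * ε) + (Real.exp (2 * ε))⁻¹ = 4 * Real.cosh ε ^ 2 := by
      rw [Real.cosh_eq, two_mul, Real.exp_add, Real.exp_neg]
      field_simp
      ring
    rw [h3]
    have h4 : ((2 : ℕ) : ℝ) * (ε ^ 2 / 2) = ε ^ 2 := by push_cast; ring
    rw [h4] at h2
    linarith
  have h1 : (2 ^ n * Real.exp (-δ)) * Real.exp (2 * ε * (ε * n)) * (2 ^ n * Real.exp (-δ)) ≤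
      (4 * Real.exp (ε ^ 2)) ^ n := by
    calc _ ≤ A.card * Real.exp (2 * ε * (ε * n)) * A.card := by gcongr
      _ ≤ _ := key
      _ ≤ _ := by gcongr
  have h2 : (4 * Real.exp (ε ^ 2)) ^ n = 2 ^ n * 2 ^ n * Real.exp (n * ε ^ 2) := by
    rw [mul_pow, ← mul_pow 2 2, ← Real.exp_nat_mul]
    norm_num
  have h3 : (2 ^ n * Real.exp (-δ)) * Real.exp (2 * ε * (ε * n)) * (2 ^ n * Real.exp (-δ)) =
      2 ^ n * 2 ^ n * Real.exp (-δ + 2 * ε * (ε * n) + -δ) := by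
    rw [Real.exp_add, Real.exp_add]
    ring
  rw [h2, h3] at h1
  have h4 := Real.exp_le_exp.1 (le_of_mul_le_mul_left h1 (by positivity))
  nlinarith

/-- Pigeonhole principle for sparse vectors: if the integer vectors `g x` have few nonzero entries
on average, then some value of `g` is attained often. -/
theorem exists_large_fiber_of_sparse {X V : Type*} [Fintype X] [Nonempty X] [Fintype V]
    [DecidableEq V] (g : X → V → ℤ) (I : Finset ℤ) (hI : ∀ x v, g x v ∈ I) {μ s : ℝ} (hμ : 0 ≤ μ)
    (hs : ∑ x, ((Finset.univ.filter fun v => g x v ≠ 0).card : ℝ) ≤ Fintype.card X * s) :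
    ∃ f : V → ℤ, Fintype.card X * Real.exp (-(μ * s)) ≤
      ((Finset.univ.filter fun x => g x = f).card : ℝ) *
        (1 + I.card * Real.exp (-μ)) ^ Fintype.card V := by
  set S : (V → ℤ) → ℝ := fun f => ((Finset.univ.filter fun v => f v ≠ 0).card : ℝ) with hS
  have hjensen : Fintype.card X * Real.exp (-(μ * s)) ≤ ∑ x, Real.exp (-(μ * S (g x))) := by
    have h1 : ∀ x, Real.exp (-(μ * s)) * (1 + μ * s - μ * S (g x)) ≤
        Real.exp (-(μ * S (g x))) := by
      intro x
      have := Real.add_one_le_exp (μ * s - μ * S (g x))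
      calc _ ≤ Real.exp (-(μ * s)) * Real.exp (μ * s - μ * S (g x)) := by
            gcongr
            linarith
        _ = _ := by
            rw [← Real.exp_add]
            congr 1
            ring
    refine le_trans ?_ (Finset.sum_le_sum fun x _ => h1 x)
    rw [← Finset.mul_sum, Finset.sum_sub_distrib, ← Finset.mul_sum, Finset.sum_const,
      Finset.card_univ, nsmul_eq_mul, mul_comm]
    gcongr
    nlinarith [mul_le_mul_of_nonneg_left hs hμ]
  have hweight : ∑ f ∈ Fintype.piFinset fun _ : V => I, Real.exp (-(μ * S f)) ≤
      (1 + I.card * Real.exp (-μ)) ^ Fintype.card V := by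
    have e : ∀ f : V → ℤ, Real.exp (-(μ * S f)) =
        ∏ v, if f v ≠ 0 then Real.exp (-μ) else 1 := by
      intro f
      rw [Finset.prod_ite, Finset.prod_const, Finset.prod_const_one, mul_one, ← Real.exp_nat_mul]
      congr 1
      ring
    simp_rw [e]
    rw [← Finset.prod_univ_sum (fun _ : V => I)
      (fun _ j => if j ≠ 0 then Real.exp (-μ) else 1), Finset.prod_const, Finset.card_univ]
    refine pow_le_pow_left₀ (Finset.sum_nonneg fun j _ => by positivity) ?_ _
    · calc _ ≤ ∑ j ∈ I, ((if j = 0 then 1 else 0) + Real.exp (-μ)) :=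
            Finset.sum_le_sum fun j _ => by
              have := Real.exp_pos (-μ)
              by_cases hj : j = 0 <;> simp [hj, this.le]
        _ ≤ _ := by
            rw [Finset.sum_add_distrib, Finset.sum_const, nsmul_eq_mul, Finset.sum_ite_eq']
            gcongr
            split_ifs <;> norm_num
  by_contra! hcon
  have hmaps : ∀ x ∈ Finset.univ, g x ∈ Fintype.piFinset fun _ : V => I :=
    fun x _ => Fintype.mem_piFinset.2 (hI x)
  set W := (1 + I.card * Real.exp (-μ)) ^ Fintype.card V with hW
  have hWpos : 0 < W := by positivity
  set c := Fintype.card X * Real.exp (-(μ * s)) / W with hc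
  have hfib : ∀ f : V → ℤ, ((Finset.univ.filter fun x => g x = f).card : ℝ) < c := fun f => by
    rw [hc, lt_div_iff₀ hWpos]
    exact hcon f
  have hne : (Fintype.piFinset fun _ : V => I).Nonempty :=
    ⟨_, hmaps (Classical.arbitrary X) (Finset.mem_univ _)⟩
  have h1 : ∑ x, Real.exp (-(μ * S (g x))) <
      c * ∑ f ∈ Fintype.piFinset fun _ : V => I, Real.exp (-(μ * S f)) := by
    rw [← Finset.sum_fiberwise_of_maps_to hmaps, Finset.mul_sum]
    refine Finset.sum_lt_sum_of_nonempty hne fun f _ => ?_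
    rw [Finset.sum_congr rfl fun x hx => by rw [(Finset.mem_filter.1 hx).2], Finset.sum_const,
      nsmul_eq_mul]
    exact mul_lt_mul_of_pos_right (hfib f) (Real.exp_pos _)
  have hc0 : 0 ≤ c := by positivity
  have h2 := mul_le_mul_of_nonneg_left hweight hc0
  have h3 : c * W = Fintype.card X * Real.exp (-(μ * s)) := by
    rw [hc]
    field_simp
  linarith

theorem exists_forall_abs_signed_sum_lt {ι V : Type*} [Fintype ι] [DecidableEq ι] [Fintype V]
    (a : V → ι → ℝ) {S t : ℝ} (hS : 0 < S) (ht : 0 ≤ t) (ha : ∀ v, ∑ i, a v i ^ 2 ≤ S)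
    (hV : Fintype.card V * (2 * Real.exp (-(t ^ 2 / (2 * S)))) < 1) :
    ∃ x : ι → Bool, ∀ v, |∑ i, (boolSign (x i) : ℝ) * a v i| < t := by
  classical
  by_contra! hcon
  set bad : V → Finset (ι → Bool) := fun v =>
    Finset.univ.filter fun x => t ≤ |∑ i, (boolSign (x i) : ℝ) * a v i| with hbad
  have hcover : (Finset.univ : Finset (ι → Bool)) ⊆ Finset.univ.biUnion bad := by
    intro x _
    obtain ⟨v, hv⟩ := hcon x
    exact Finset.mem_biUnion.2 ⟨v, Finset.mem_univ _, by simpa [hbad] using hv⟩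
  have h1 := (Finset.card_le_card hcover).trans Finset.card_biUnion_le
  rw [Finset.card_univ, Fintype.card_fun, Fintype.card_bool] at h1
  have h2 : (2 : ℝ) ^ Fintype.card ι ≤ ∑ v, ((bad v).card : ℝ) := by exact_mod_cast h1
  have h3 : ∑ v, ((bad v).card : ℝ) ≤
      ∑ _v : V, 2 * 2 ^ Fintype.card ι * Real.exp (-(t ^ 2 / (2 * S))) :=
    Finset.sum_le_sum fun v _ => card_le_abs_signed_sum_le (a v) hS ht (ha v)
  rw [Finset.sum_const, Finset.card_univ, nsmul_eq_mul] at h3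
  have h4 : (0 : ℝ) < 2 ^ Fintype.card ι := by positivity
  have h5 := mul_lt_mul_of_pos_left hV h4
  linarith

theorem exists_nat_forall_log_mul_exp_neg_lt {c η : ℝ} (hc : 0 < c) (hη : 0 < η) :
    ∃ N : ℕ, ∀ n : ℕ, N ≤ n →
      2 * (12 * n * Real.log n * Real.exp (-(c * Real.log n)) + 2) < η * n := by
  have hlog : Filter.Tendsto (fun n : ℕ => c * Real.log n) Filter.atTop Filter.atTop :=
    (Real.tendsto_log_atTop.comp tendsto_natCast_atTop_atTop).const_mul_atTop hc
  have h1 := (Real.tendsto_pow_mul_exp_neg_atTop_nhds_zero 1).comp hlog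
  have h2 := h1.eventually_lt_const (show (0 : ℝ) < η * c / 48 by positivity)
  have h3 := (tendsto_natCast_atTop_atTop (R := ℝ)).eventually_gt_atTop (8 / η)
  obtain ⟨N, hN⟩ := Filter.eventually_atTop.1 (h2.and h3)
  refine ⟨N, fun n hn => ?_⟩
  obtain ⟨ha, hb⟩ := hN n hn
  simp only [Function.comp, pow_one] at ha
  rw [div_lt_iff₀ hη] at hb
  have hn0 : (0 : ℝ) < n := by nlinarith [Nat.cast_nonneg (α := ℝ) n]
  have h4 : Real.log n * Real.exp (-(c * Real.log n)) < η / 48 := by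
    refine lt_of_mul_lt_mul_left ?_ hc.le
    linarith
  have h5 := mul_lt_mul_of_pos_left h4 hn0
  nlinarith

/-- Integer vectors with bounded entries: `2n` linear forms in `n` signs can be made
simultaneously smaller than `√(n log n)`. -/
theorem exists_signing_abs_lt_sqrt_log (r : ℕ) (hr : 0 < r) :
    ∃ N : ℕ, ∀ n : ℕ, N ≤ n → ∀ (V : Type) [Fintype V] [DecidableEq V],
      Fintype.card V = 2 * n → ∀ a : V → Fin n → ℤ, (∀ v i, |a v i| ≤ r) →
        ∃ x : Fin n → Bool, ∀ v,
          |((∑ i, boolSign (x i) * a v i : ℤ) : ℝ)| < Real.sqrt (n * Real.log n) := by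
  have hr0 : (0 : ℝ) < r := by exact_mod_cast hr
  set c : ℝ := 1 / (32 * r ^ 2) with hc
  set ε : ℝ := 1 / (16 * r ^ 2) with hε
  have hc0 : 0 < c := by positivity
  have hε0 : 0 < ε := by positivity
  obtain ⟨N, hN⟩ := exists_nat_forall_log_mul_exp_neg_lt hc0 (pow_pos hε0 2)
  refine ⟨max N (max 5 (2 * r + 1)), fun n hn V _ _ hV a ha => ?_⟩
  have hbig := hN n (le_trans (le_max_left _ _) hn)
  have hn5 : 5 ≤ n := le_trans (le_trans (le_max_left _ _) (le_max_right _ _)) hn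
  have hnr : 2 * r + 1 ≤ n := le_trans (le_trans (le_max_right _ _) (le_max_right _ _)) hn
  have hn5' : (5 : ℝ) ≤ n := by exact_mod_cast hn5
  have hnr' : (2 * r + 1 : ℝ) ≤ n := by exact_mod_cast hnr
  have hn0 : (0 : ℝ) < n := by linarith
  set L := Real.log n with hL
  have hL0 : 0 < L := Real.log_pos (by linarith)
  have hexpL : Real.exp L = n := Real.exp_log hn0
  set T := Real.sqrt (n * L) with hT
  have hT0 : 0 < T := Real.sqrt_pos.2 (by positivity)
  have hT2 : T ^ 2 = n * L := Real.sq_sqrt (by positivity)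
  have haR : ∀ v i, (a v i : ℝ) ^ 2 ≤ r ^ 2 := by
    intro v i
    rw [sq_le_sq, Nat.abs_cast]
    exact_mod_cast ha v i
  set F : V → (Fin n → Bool) → ℤ := fun v x => ∑ i, boolSign (x i) * a v i with hF
  have hFcast : ∀ v x, (F v x : ℝ) = ∑ i, (boolSign (x i) : ℝ) * (a v i : ℝ) := by
    intro v x
    simp [hF]
  have hFle : ∀ v x, |F v x| ≤ r * n := by
    intro v x
    refine (Finset.abs_sum_le_sum_abs _ _).trans ?_
    refine (Finset.sum_le_card_nsmul _ _ (r : ℤ) fun i _ => ?_).trans_eq ?_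
    · rw [abs_mul]
      have : |boolSign (x i)| = 1 := by cases x i <;> simp [boolSign]
      rw [this, one_mul]
      exact ha v i
    · simp [mul_comm]
  set g : (Fin n → Bool) → V → ℤ := fun x v => if |(F v x : ℝ)| < T / 4 then 0 else F v x with hg
  -- few linear forms are large on average
  have hs : ∑ x, ((Finset.univ.filter fun v => g x v ≠ 0).card : ℝ) ≤
      Fintype.card (Fin n → Bool) * (4 * n * Real.exp (-(c * L))) := by
    have hle : ∀ x, ((Finset.univ.filter fun v => g x v ≠ 0).card : ℝ) ≤
        ∑ v, if T / 4 ≤ |∑ i, (boolSign (x i) : ℝ) * (a v i : ℝ)| then (1 : ℝ) else 0 := by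
      intro x
      rw [Finset.sum_boole]
      refine Nat.cast_le.2 (Finset.card_le_card fun v hv => ?_)
      simp only [hg, Finset.mem_filter, Finset.mem_univ, true_and, ne_eq, ite_eq_left_iff,
        not_forall, not_lt] at hv ⊢
      rw [← hFcast]
      exact hv.1
    refine (Finset.sum_le_sum fun x _ => hle x).trans ?_
    rw [Finset.sum_comm]
    have hv : ∀ v, (∑ x : Fin n → Bool,
        if T / 4 ≤ |∑ i, (boolSign (x i) : ℝ) * (a v i : ℝ)| then (1 : ℝ) else 0) ≤
        2 * 2 ^ n * Real.exp (-(c * L)) := by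
      intro v
      rw [Finset.sum_boole]
      have := card_le_abs_signed_sum_le (fun i => (a v i : ℝ)) (S := n * r ^ 2) (t := T / 4)
        (by positivity) (by positivity)
        ((Finset.sum_le_sum fun i _ => haR v i).trans_eq (by simp))
      rw [Fintype.card_fin] at this
      refine this.trans_eq ?_
      congr 3
      rw [div_pow, hT2, hc]
      field_simp
      norm_num
    refine (Finset.sum_le_sum fun v _ => hv v).trans_eq ?_
    rw [Finset.sum_const, Finset.card_univ, hV, nsmul_eq_mul, Fintype.card_fun, Fintype.card_bool,
      Fintype.card_fin]
    push_cast
    ring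
  obtain ⟨f, hf⟩ := exists_large_fiber_of_sparse g (Finset.Icc (-(r * n : ℤ)) (r * n))
    (fun x v => by
      rw [Finset.mem_Icc, ← abs_le]
      simp only [hg]
      split_ifs
      · rw [abs_zero]
        positivity
      · exact hFle v x) (μ := 3 * L) (by positivity) hs
  set A := Finset.univ.filter fun x => g x = f with hA
  have hW : (1 + ((Finset.Icc (-(r * n : ℤ)) (r * n)).card : ℝ) * Real.exp (-(3 * L))) ^
      Fintype.card V ≤ Real.exp 2 := by
    have hcard : ((Finset.Icc (-(r * n : ℤ)) (r * n)).card : ℝ) = 2 * r * n + 1 := by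
      have h1 : (Finset.Icc (-(r * n : ℤ)) (r * n)).card = 2 * r * n + 1 := by
        rw [Int.card_Icc]
        have : (r * n : ℤ) + 1 - -(r * n) = ((2 * r * n + 1 : ℕ) : ℤ) := by
          push_cast
          ring
        rw [this, Int.toNat_natCast]
      rw [h1]
      push_cast
      ring
    have hexp : Real.exp (-(3 * L)) = ((n : ℝ) ^ 3)⁻¹ := by
      rw [Real.exp_neg, ← hexpL, ← Real.exp_nat_mul]
      norm_num
    have hbase : 1 + (2 * r * n + 1) * Real.exp (-(3 * L)) ≤ Real.exp (1 / n) := by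
      refine le_trans ?_ (Real.add_one_le_exp _)
      rw [add_comm, hexp]
      gcongr
      rw [← div_eq_mul_inv, div_le_div_iff₀ (by positivity) hn0]
      nlinarith [mul_le_mul_of_nonneg_right hnr' (sq_nonneg (n : ℝ))]
    rw [hcard, hV]
    refine (pow_le_pow_left₀ (by positivity) hbase _).trans_eq ?_
    rw [← Real.exp_nat_mul]
    congr 1
    push_cast
    field_simp
  have hAcard : 2 ^ n * Real.exp (-(3 * L * (4 * n * Real.exp (-(c * L))) + 2)) ≤ A.card := by
    have h1 := hf.trans (mul_le_mul_of_nonneg_left hW (Nat.cast_nonneg _))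
    rw [Fintype.card_fun, Fintype.card_bool, Fintype.card_fin] at h1
    rw [neg_add, Real.exp_add, Real.exp_neg 2, ← mul_assoc, ← div_eq_mul_inv,
      div_le_iff₀ (Real.exp_pos _)]
    exact_mod_cast h1
  obtain ⟨x, hx, y, hy, hxy⟩ := exists_card_agree_le A hε0.le (by linarith) hAcard
  have hclose : ∀ v, |(F v x : ℝ) - F v y| < T / 2 := by
    intro v
    have h1 : g x v = g y v := by
      rw [(Finset.mem_filter.1 hx).2, (Finset.mem_filter.1 hy).2]
    simp only [hg] at h1
    by_cases hx4 : |(F v x : ℝ)| < T / 4 <;> by_cases hy4 : |(F v y : ℝ)| < T / 4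
    · rw [abs_lt] at *
      constructor <;> linarith [hx4.1, hx4.2, hy4.1, hy4.2]
    · rw [if_pos hx4, if_neg hy4] at h1
      rw [← h1] at hy4
      simp at hy4
      linarith
    · rw [if_pos hy4, if_neg hx4] at h1
      rw [h1] at hx4
      simp at hx4
      linarith
    · rw [if_neg hx4, if_neg hy4] at h1
      rw [h1, sub_self, abs_zero]
      positivity
  -- the coordinates where `x` and `y` agree are signed at random
  obtain ⟨u, hu⟩ := exists_forall_abs_signed_sum_lt
    (fun v i => if x i = y i then (a v i : ℝ) else 0) (S := ε * n * r ^ 2) (t := T / 2)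
    (by positivity) (by positivity)
    (fun v => by
      calc _ ≤ ∑ i, if x i = y i then (r : ℝ) ^ 2 else 0 := by
            refine Finset.sum_le_sum fun i _ => ?_
            split_ifs
            · exact haR v i
            · simp
        _ = ((Finset.univ.filter fun i => x i = y i).card : ℝ) * r ^ 2 := by
            rw [← Finset.sum_filter, Finset.sum_const, nsmul_eq_mul]
        _ ≤ _ := by gcongr)
    (by
      have h1 : (T / 2) ^ 2 / (2 * (ε * n * r ^ 2)) = 2 * L := by
        rw [div_pow, hT2, hε]
        field_simp
        norm_num
      have h2 : Real.exp (-(2 * L)) = ((n : ℝ) ^ 2)⁻¹ := by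
        rw [Real.exp_neg, ← hexpL, ← Real.exp_nat_mul]
        norm_num
      rw [h1, h2, hV]
      push_cast
      rw [show 2 * (n : ℝ) * (2 * ((n : ℝ) ^ 2)⁻¹) = 4 / n by field_simp; norm_num,
        div_lt_one hn0]
      linarith)
  refine ⟨fun i => if x i = y i then u i else x i, fun v => ?_⟩
  have hsplit : ((∑ i, boolSign (if x i = y i then u i else x i) * a v i : ℤ) : ℝ) =
      ((F v x : ℝ) - F v y) / 2 +
        ∑ i, (boolSign (u i) : ℝ) * (if x i = y i then (a v i : ℝ) else 0) := by
    rw [hFcast v x, hFcast v y, ← Finset.sum_sub_distrib, Finset.sum_div,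
      ← Finset.sum_add_distrib]
    push_cast
    refine Finset.sum_congr rfl fun i _ => ?_
    by_cases hi : x i = y i
    · simp [hi]
    · have hy' : y i = !(x i) := by
        revert hi
        cases x i <;> cases y i <;> simp
      rw [if_neg hi, if_neg hi, hy', boolSign_not]
      push_cast
      ring
  have h1 := hclose v
  have h2 := hu v
  rw [hsplit]
  rw [abs_lt] at *
  constructor <;> linarith [h1.1, h1.2, h2.1, h2.2]

/-- For every positive integer `r` there is `N = N(r)` such that for all `n ≥ N`,
the vertex set of any multigraph of order `2n` with multiplicity at most `r` can be
partitioned into two equal parts `A` and `B` such that every vertex `v` satisfies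
`|d_A(v) − d_B(v)| < √(n · log n)`. -/
theorem balanced_partition_of_multigraph_sqrt_log (r : ℕ) (hr : 0 < r) :
    ∃ N : ℕ, ∀ n : ℕ, N ≤ n →
      ∀ (V : Type) [Fintype V] [DecidableEq V], Fintype.card V = 2 * n →
        ∀ m : V → V → ℕ,
          (∀ u v, m u v = m v u) → (∀ v, m v v = 0) →
          (∀ u v, m u v ≤ r) →
          ∃ A B : Finset V,
            Disjoint A B ∧ A ∪ B = Finset.univ ∧
            A.card = n ∧ B.card = n ∧
            ∀ v : V,
              |(∑ x ∈ A, (m v x : ℝ)) - ∑ x ∈ B, (m v x : ℝ)| <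
                Real.sqrt ((n : ℝ) * Real.log (n : ℝ)) := by
  obtain ⟨N, hN⟩ := exists_signing_abs_lt_sqrt_log r hr
  refine ⟨N, fun n hn V _ _ hV m _ _ hm => ?_⟩
  have e : V ≃ Fin n × Bool := Fintype.equivOfCardEq (by simp [hV, mul_comm])
  obtain ⟨x, hx⟩ := hN n hn V hV
    (fun v i => (m v (e.symm (i, true)) : ℤ) - m v (e.symm (i, false))) fun v i => by
      have h1 := hm v (e.symm (i, true))
      have h2 := hm v (e.symm (i, false))
      rw [abs_le]
      constructor <;> omega
  have hsum : ∀ (s : Bool → Bool) (f : V → ℝ),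
      ∑ w ∈ Finset.univ.filter (fun w => (e w).2 = s (x (e w).1)), f w =
        ∑ i, f (e.symm (i, s (x i))) := by
    intro s f
    rw [Finset.sum_filter, ← e.symm.sum_comp, Fintype.sum_prod_type]
    refine Finset.sum_congr rfl fun i _ => ?_
    simp
  have hcard : ∀ s : Bool → Bool,
      (Finset.univ.filter fun w => (e w).2 = s (x (e w).1)).card = n := by
    intro s
    have := hsum s fun _ => 1
    simp only [Finset.sum_const, nsmul_eq_mul, mul_one, Finset.card_univ, Fintype.card_fin] at this
    exact_mod_cast this
  refine ⟨Finset.univ.filter fun w => (e w).2 = id (x (e w).1),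
    Finset.univ.filter fun w => (e w).2 = not (x (e w).1), ?_, ?_, hcard _, hcard _, fun v => ?_⟩
  · rw [Finset.disjoint_filter]
    intro w _ h1 h2
    rw [h1] at h2
    simp at h2
  · ext w
    simp only [Finset.mem_union, Finset.mem_filter, Finset.mem_univ, true_and, iff_true, id]
    cases (e w).2 <;> cases x (e w).1 <;> simp
  · rw [hsum, hsum, ← Finset.sum_sub_distrib]
    convert hx v using 2
    push_cast
    refine Finset.sum_congr rfl fun i _ => ?_
    cases x i <;> simp [boolSign]
end
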